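/- arXiv:1812.11616 — 2 statements merged into one kernel-verified Lean document; each statement's English description precedes it below -/
import Mathlib

section
/- (Bourgain's counterexample, odd dimensions.) Let n ≥ 3 be odd, write x = (x′, x_n) ∈ ℝ^{n−1}×ℝ, and define the phase ϕ(x;y′) := ⟨x′, y′⟩ + (1/2) ∑_{j=0}^{(n−3)/2} ( y²_{2j+1} + 2 x_n y_{2j+1} y_{2j+2} + x_n² y²_{2j+2} ) on ℝⁿ×ℝ^{n−1}. Let a ∈ C_c^∞(ℝⁿ×ℝ^{n−1}) be supported in a sufficiently small neighbourhood of the origin with a(0;0) ≠ 0, and set T_λ f(x) := ∫_{ℝ^{n−1}} e^{iλϕ(x;y′)} a(x;y′) f(y′) dy′. Then for every p ≥ 2 there exist c > 0 and λ₀ ≥ 1 such that for every λ ≥ λ₀ there is a bounded measurable f : ℝ^{n−1} → ℂ with ‖f‖_{L^∞(ℝ^{n−1})} ≤ 1 and ‖T_λ f‖_{L^p(ℝⁿ)} ≥ c λ^{−(n−1)/4 − (n−1)/(2p)}. -/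
open MeasureTheory
open scoped ENNReal

noncomputable section

/-- The index `k` (taken mod `m`) as an element of `Fin m`. -/
def idx (m : ℕ) (hm : 0 < m) (k : ℕ) : Fin m := ⟨k % m, Nat.mod_lt k hm⟩

/-- `∑_{j<J} ⟨A(s)(y_{2j+1},y_{2j+2}),(y_{2j+1},y_{2j+2})⟩` where `A(s) = [[1,s],[s,s²]]`
(`0`-based coordinates). -/
def pairSum (m : ℕ) (hm : 0 < m) (J : ℕ) (s : ℝ) (y : Fin m → ℝ) : ℝ :=
  ∑ j ∈ Finset.range J,
    ((y (idx m hm (2 * j))) ^ 2 + 2 * s * (y (idx m hm (2 * j))) * (y (idx m hm (2 * j + 1)))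
      + s ^ 2 * (y (idx m hm (2 * j + 1))) ^ 2)

/-- Bourgain's phase in odd dimensions:
`ϕ(x;y′) = ⟨x′,y′⟩ + (1/2)∑_{j=0}^{(n−3)/2}(y²_{2j+1} + 2x_n y_{2j+1}y_{2j+2} + x_n² y²_{2j+2})`,
where `x = (x′,x_n) ∈ ℝ^{n−1} × ℝ`. -/
def bourgainPhaseOdd (n : ℕ) (hn : 3 ≤ n) (x : (Fin (n - 1) → ℝ) × ℝ)
    (y : Fin (n - 1) → ℝ) : ℝ :=
  (∑ j : Fin (n - 1), x.1 j * y j)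
    + (1 / 2) * pairSum (n - 1) (by omega) ((n - 1) / 2) x.2 y

/-- The oscillatory integral operator
`T_λ f(x) = ∫_{ℝ^{n−1}} e^{iλϕ(x;y′)} a(x;y′) f(y′) dy′`, `x = (x′,x_n) ∈ ℝ^{n−1}×ℝ`. -/
def oscIntP {m : ℕ} (lam : ℝ) (ϕ : ((Fin m → ℝ) × ℝ) → (Fin m → ℝ) → ℝ)
    (a : (((Fin m → ℝ) × ℝ) × (Fin m → ℝ)) → ℂ) (f : (Fin m → ℝ) → ℂ)
    (x : (Fin m → ℝ) × ℝ) : ℂ :=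
  ∫ y : Fin m → ℝ, Complex.exp (Complex.I * ((lam * ϕ x y : ℝ) : ℂ)) * a (x, y) * f y

section BourgainCounterexample

open Filter Topology
open scoped Real InnerProductSpace FourierTransform SchwartzMap

theorem norm_cexp_fresnel_le_one {ε lam t : ℝ} (hε : 0 ≤ ε) (ht : 0 ≤ t) :
    ‖Complex.exp ((2 * π * Complex.I) ^ 2 * (t : ℂ) / (4 * ((ε : ℂ) - Complex.I * (lam / 2 : ℝ))))‖
      ≤ 1 := by
  rw [Complex.norm_exp, Real.exp_le_one_iff]
  have h : ((2 * π * Complex.I) ^ 2 * (t : ℂ) / (4 * ((ε : ℂ) - Complex.I * (lam / 2 : ℝ))))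
      = ((-(π ^ 2 * t) : ℝ) : ℂ) * ((ε : ℂ) - Complex.I * (lam / 2 : ℝ))⁻¹ := by
    rw [mul_pow, mul_pow, Complex.I_sq, div_eq_mul_inv, mul_inv]
    push_cast
    ring
  rw [h, Complex.re_ofReal_mul, Complex.inv_re]
  have h2 : ((ε : ℂ) - Complex.I * (lam / 2 : ℝ)).re = ε := by simp
  rw [h2]
  have : 0 ≤ ε / Complex.normSq ((ε : ℂ) - Complex.I * (lam / 2 : ℝ)) :=
    div_nonneg hε (Complex.normSq_nonneg _)
  have h3 : 0 ≤ π ^ 2 * t := by positivity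
  nlinarith

/-- The Gaussian integral of a superposition of plane waves. -/
theorem integral_gaussian_mul_superposition {Ω U : Type*} [MeasurableSpace Ω] {μ : Measure Ω}
    [SFinite μ] [NormedAddCommGroup U] [InnerProductSpace ℝ U] [FiniteDimensional ℝ U]
    [MeasurableSpace U] [BorelSpace U] {G : Ω → ℂ} (hG : Integrable G μ) {θ : Ω → U}
    (hθ : Measurable θ) {b : ℂ} (hb : 0 < b.re) :
    ∫ u : U, Complex.exp (-b * ‖u‖ ^ 2) *
        ∫ ω, Complex.exp (2 * π * Complex.I * ⟪θ ω, u⟫_ℝ) * G ω ∂μ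
      = (π / b) ^ (Module.finrank ℝ U / 2 : ℂ) *
        ∫ ω, Complex.exp ((2 * π * Complex.I) ^ 2 * ‖θ ω‖ ^ 2 / (4 * b)) * G ω ∂μ := by
  have hgauss : Integrable (fun u : U => Complex.exp (-b * ‖u‖ ^ 2)) := by
    simpa using GaussianFourier.integrable_cexp_neg_mul_sq_norm_add hb 0 (0 : U)
  have hmeas : Measurable fun z : U × Ω => Complex.exp (2 * π * Complex.I * ⟪θ z.2, z.1⟫_ℝ) := by
    have : Measurable fun z : U × Ω => ⟪θ z.2, z.1⟫_ℝ :=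
      (hθ.comp measurable_snd).inner measurable_fst
    fun_prop
  have hint : Integrable (Function.uncurry fun (u : U) (ω : Ω) => Complex.exp (-b * ‖u‖ ^ 2) *
      (Complex.exp (2 * π * Complex.I * ⟪θ ω, u⟫_ℝ) * G ω)) (volume.prod μ) := by
    have h := (hgauss.mul_prod hG).bdd_mul (c := 1) hmeas.aestronglyMeasurable
      (ae_of_all _ fun z => by
        rw [show 2 * (π : ℂ) * Complex.I * (⟪θ z.2, z.1⟫_ℝ : ℂ)
          = ((2 * π * ⟪θ z.2, z.1⟫_ℝ : ℝ) : ℂ) * Complex.I by push_cast; ring,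
          Complex.norm_exp_ofReal_mul_I])
    refine h.congr (ae_of_all _ fun z => ?_)
    simp only [Function.uncurry]
    ring
  simp_rw [← integral_const_mul]
  rw [integral_integral_swap hint]
  refine integral_congr_ae (ae_of_all _ fun ω => ?_)
  simp only
  rw [← mul_assoc, ← GaussianFourier.integral_cexp_neg_mul_sq_norm_add hb, ← integral_mul_const]
  refine integral_congr_ae (ae_of_all _ fun u => ?_)
  simp only
  rw [← mul_assoc, ← Complex.exp_add]

/-- The Fresnel integral of an integrable superposition of plane waves. -/
theorem integral_fresnel_mul_superposition {Ω U : Type*} [MeasurableSpace Ω] {μ : Measure Ω}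
    [SFinite μ] [NormedAddCommGroup U] [InnerProductSpace ℝ U] [FiniteDimensional ℝ U]
    [MeasurableSpace U] [BorelSpace U] {G : Ω → ℂ} (hG : Integrable G μ) {θ : Ω → U}
    (hθ : Measurable θ) {g : U → ℂ} (hg : Integrable g)
    (hgG : ∀ u, g u = ∫ ω, Complex.exp (2 * π * Complex.I * ⟪θ ω, u⟫_ℝ) * G ω ∂μ)
    {lam : ℝ} (hlam : 0 < lam) :
    ∫ u : U, Complex.exp (-((0 : ℝ) - Complex.I * (lam / 2 : ℝ)) * ‖u‖ ^ 2) * g u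
      = (π / ((0 : ℝ) - Complex.I * (lam / 2 : ℝ))) ^ (Module.finrank ℝ U / 2 : ℂ) *
        ∫ ω, Complex.exp ((2 * π * Complex.I) ^ 2 * (‖θ ω‖ ^ 2 : ℝ) /
          (4 * ((0 : ℝ) - Complex.I * (lam / 2 : ℝ)))) * G ω ∂μ := by
  have hb : Tendsto (fun ε : ℝ => (ε : ℂ) - Complex.I * (lam / 2 : ℝ)) (𝓝[>] 0)
      (𝓝 ((0 : ℝ) - Complex.I * (lam / 2 : ℝ))) :=
    (Continuous.tendsto (by fun_prop) 0).mono_left nhdsWithin_le_nhds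
  have hb0 : ((0 : ℝ) : ℂ) - Complex.I * (lam / 2 : ℝ) ≠ 0 := by
    intro h
    have := congrArg Complex.im h
    simp at this
    linarith
  have hL : Tendsto (fun ε : ℝ => ∫ u : U,
      Complex.exp (-((ε : ℝ) - Complex.I * (lam / 2 : ℝ)) * ‖u‖ ^ 2) * g u) (𝓝[>] 0)
      (𝓝 (∫ u : U, Complex.exp (-((0 : ℝ) - Complex.I * (lam / 2 : ℝ)) * ‖u‖ ^ 2) * g u)) := by
    refine tendsto_integral_filter_of_dominated_convergence (fun u => ‖g u‖) ?_ ?_ hg.norm ?_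
    · refine Eventually.of_forall fun ε => ?_
      exact (Continuous.aestronglyMeasurable (by fun_prop)).mul hg.aestronglyMeasurable
    · filter_upwards [self_mem_nhdsWithin] with ε hε
      refine ae_of_all _ fun u => ?_
      rw [norm_mul]
      refine mul_le_of_le_one_left (norm_nonneg _) ?_
      rw [Complex.norm_exp, Real.exp_le_one_iff]
      have : (-((ε : ℂ) - Complex.I * (lam / 2 : ℝ)) * (‖u‖ : ℂ) ^ 2).re = -ε * ‖u‖ ^ 2 := by
        rw [← Complex.ofReal_pow, Complex.re_mul_ofReal]
        simp
      rw [this]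
      have hε' : 0 < ε := hε
      nlinarith [sq_nonneg ‖u‖]
    · refine ae_of_all _ fun u => ?_
      exact ((Complex.continuous_exp.tendsto _).comp (hb.neg.mul_const _)).mul_const _
  have hR : Tendsto (fun ε : ℝ => (π / ((ε : ℝ) - Complex.I * (lam / 2 : ℝ))) ^
        (Module.finrank ℝ U / 2 : ℂ) *
        ∫ ω, Complex.exp ((2 * π * Complex.I) ^ 2 * (‖θ ω‖ ^ 2 : ℝ) /
          (4 * ((ε : ℝ) - Complex.I * (lam / 2 : ℝ)))) * G ω ∂μ) (𝓝[>] 0)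
      (𝓝 ((π / ((0 : ℝ) - Complex.I * (lam / 2 : ℝ))) ^ (Module.finrank ℝ U / 2 : ℂ) *
        ∫ ω, Complex.exp ((2 * π * Complex.I) ^ 2 * (‖θ ω‖ ^ 2 : ℝ) /
          (4 * ((0 : ℝ) - Complex.I * (lam / 2 : ℝ)))) * G ω ∂μ)) := by
    refine Tendsto.mul ?_ ?_
    · refine Tendsto.cpow (tendsto_const_nhds.div hb hb0) tendsto_const_nhds ?_
      right
      have h : (π : ℂ) / ((0 : ℝ) - Complex.I * (lam / 2 : ℝ)) = ((2 * π / lam : ℝ) : ℂ) * Complex.I := by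
        rw [div_eq_iff hb0]
        push_cast
        have : (lam : ℂ) ≠ 0 := by exact_mod_cast hlam.ne'
        field_simp
        linear_combination (lam : ℂ) * Complex.I_sq
      rw [h, Complex.im_ofReal_mul, Complex.I_im]
      positivity
    · refine tendsto_integral_filter_of_dominated_convergence (fun ω => ‖G ω‖) ?_ ?_ hG.norm ?_
      · refine Eventually.of_forall fun ε => ?_
        exact (Measurable.aestronglyMeasurable (by fun_prop)).mul hG.aestronglyMeasurable
      · filter_upwards [self_mem_nhdsWithin] with ε hε
        refine ae_of_all _ fun ω => ?_
        rw [norm_mul]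
        exact mul_le_of_le_one_left (norm_nonneg _)
          (norm_cexp_fresnel_le_one (le_of_lt hε) (sq_nonneg _))
      · refine ae_of_all _ fun ω => ?_
        refine ((Complex.continuous_exp.tendsto _).comp ?_).mul_const _
        exact tendsto_const_nhds.div (hb.const_mul 4) (mul_ne_zero (by norm_num) hb0)
  refine tendsto_nhds_unique_of_eventuallyEq hL hR ?_
  filter_upwards [self_mem_nhdsWithin] with ε hε
  have h : 0 < ((ε : ℂ) - Complex.I * (lam / 2 : ℝ)).re := by simpa using hε
  have := integral_gaussian_mul_superposition (U := U) hG hθ h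
  simp_rw [hgG]
  rw [this]
  push_cast
  rfl

theorem norm_fresnel_const {lam : ℝ} (hlam : 0 < lam) (d : ℕ) :
    ‖((π : ℂ) / ((0 : ℝ) - Complex.I * (lam / 2 : ℝ))) ^ (d / 2 : ℂ)‖
      = (2 * π / lam) ^ (d / 2 : ℝ) := by
  have h : ((d / 2 : ℝ) : ℂ) = (d / 2 : ℂ) := by push_cast; rfl
  rw [← h, Complex.norm_cpow_real]
  congr 1
  simp [abs_of_pos hlam, abs_of_pos Real.pi_pos]
  field_simp

/-- Leading-order stationary phase for a quadratic phase along a family of parallel affine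
subspaces, uniformly in the subspace. -/
theorem exists_forall_norm_fresnel_sub_le {U X : Type*}
    [NormedAddCommGroup U] [InnerProductSpace ℝ U] [FiniteDimensional ℝ U]
    [MeasurableSpace U] [BorelSpace U] [NormedAddCommGroup X] [NormedSpace ℝ X]
    [FiniteDimensional ℝ X] {a : X → ℂ} (ha : ContDiff ℝ (⊤ : ℕ∞) a) (hac : HasCompactSupport a)
    {ι : U →ₗ[ℝ] X} (hι : Function.Injective ι) {ε : ℝ} (hε : 0 < ε) :
    ∃ lam₀ : ℝ, 0 < lam₀ ∧ ∀ lam, lam₀ ≤ lam → ∃ K : ℂ,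
      ‖K‖ = (2 * π / lam) ^ (Module.finrank ℝ U / 2 : ℝ) ∧ ∀ x : X,
        ‖(∫ u : U, Complex.exp (Complex.I * (lam / 2 * ‖u‖ ^ 2 : ℝ)) * a (x + ι u)) - K * a x‖
          ≤ ε * ‖K‖ := by
  set e := toEuclidean (E := X)
  set F : 𝓢(EuclideanSpace ℝ (Fin (Module.finrank ℝ X)), ℂ) :=
    HasCompactSupport.toSchwartzMap (f := a ∘ e.symm)
      (hac.comp_homeomorph e.symm.toHomeomorph) (ha.comp e.symm.contDiff) with hF
  set G : EuclideanSpace ℝ (Fin (Module.finrank ℝ X)) → ℂ :=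
    ⇑(𝓕 F : 𝓢(EuclideanSpace ℝ (Fin (Module.finrank ℝ X)), ℂ)) with hGdef
  have hG : Integrable G := (𝓕 F).integrable
  have hinv : ∀ x, a x = ∫ ζ, Complex.exp (2 * π * Complex.I * ⟪ζ, e x⟫_ℝ) * G ζ := by
    intro x
    have h1 : 𝓕⁻ (𝓕 F) = F := FourierTransform.fourierInv_fourier_eq F
    have h2 : (𝓕⁻ (𝓕 F)) (e x) = a x := by
      rw [h1]
      change a (e.symm (e x)) = a x
      rw [e.symm_apply_apply]
    rw [← h2, SchwartzMap.fourierInv_coe, Real.fourierInv_eq']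
    refine integral_congr_ae (ae_of_all _ fun ζ => ?_)
    simp only [smul_eq_mul, hGdef]
    congr 2
    push_cast
    ring
  set L : U →ₗ[ℝ] EuclideanSpace ℝ (Fin (Module.finrank ℝ X)) :=
    (e : X →ₗ[ℝ] EuclideanSpace ℝ (Fin (Module.finrank ℝ X))) ∘ₗ ι with hL
  set θ := LinearMap.adjoint L with hθdef
  have hθ : Measurable θ := θ.continuous_of_finiteDimensional.measurable
  set η : ℝ → ℝ := fun lam => ∫ ζ, ‖Complex.exp ((2 * π * Complex.I) ^ 2 * (‖θ ζ‖ ^ 2 : ℝ) /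
          (4 * ((0 : ℝ) - Complex.I * (lam / 2 : ℝ)))) - 1‖ * ‖G ζ‖ with hη
  have hηlim : Tendsto η atTop (𝓝 0) := by
    have : Tendsto η atTop (𝓝 (∫ ζ : EuclideanSpace ℝ (Fin (Module.finrank ℝ X)), (0 : ℝ))) := by
      refine tendsto_integral_filter_of_dominated_convergence (fun ω => 2 * ‖G ω‖) ?_ ?_
        (hG.norm.const_mul 2) ?_
      · refine Eventually.of_forall fun lam => ?_
        exact (Measurable.aestronglyMeasurable (by fun_prop)).mul hG.aestronglyMeasurable.norm
      · refine Eventually.of_forall fun lam => ae_of_all _ fun ω => ?_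
        rw [norm_mul, norm_norm, norm_norm]
        refine mul_le_mul_of_nonneg_right ?_ (norm_nonneg _)
        refine (norm_sub_le _ _).trans ?_
        rw [norm_one]
        have := norm_cexp_fresnel_le_one (lam := lam) le_rfl (sq_nonneg ‖θ ω‖)
        linarith
      · refine ae_of_all _ fun ω => ?_
        have h : Tendsto (fun lam : ℝ => (2 * π * Complex.I) ^ 2 * (‖θ ω‖ ^ 2 : ℝ) /
          (4 * ((0 : ℝ) - Complex.I * (lam / 2 : ℝ)))) atTop (𝓝 0) := by
          have h1 : Tendsto (fun lam : ℝ => ((lam⁻¹ : ℝ) : ℂ)) atTop (𝓝 ((0 : ℝ) : ℂ)) :=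
            (Complex.continuous_ofReal.tendsto 0).comp tendsto_inv_atTop_zero
          have h2 := h1.const_mul ((2 * π * Complex.I) ^ 2 * (‖θ ω‖ ^ 2 : ℝ) * (Complex.I / 2))
          rw [Complex.ofReal_zero, mul_zero] at h2
          refine h2.congr' ?_
          filter_upwards [eventually_gt_atTop 0] with lam hl
          have hl' : (lam : ℂ) ≠ 0 := by exact_mod_cast hl.ne'
          have := Complex.I_ne_zero
          push_cast
          rw [zero_sub]
          field_simp
          linear_combination 4 * (‖θ ω‖ : ℂ) ^ 2 * Complex.I_sq
        have h3 := (Complex.continuous_exp.tendsto _).comp h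
        rw [Complex.exp_zero] at h3
        simpa using ((h3.sub_const 1).norm.mul_const ‖G ω‖)
    simpa using this
  obtain ⟨l0, hl0⟩ := (eventually_atTop.1 (hηlim.eventually_le_const hε))
  refine ⟨max l0 1, by positivity, fun lam hlam => ?_⟩
  have hlpos : 0 < lam := lt_of_lt_of_le one_pos ((le_max_right _ _).trans hlam)
  refine ⟨_, norm_fresnel_const hlpos _, fun x => ?_⟩
  have hGx : Integrable fun ζ => Complex.exp (2 * π * Complex.I * ⟪ζ, e x⟫_ℝ) * G ζ := by
    refine hG.bdd_mul (c := 1) (Continuous.aestronglyMeasurable (by fun_prop))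
      (ae_of_all _ fun ζ => ?_)
    rw [show 2 * (π : ℂ) * Complex.I * (⟪ζ, e x⟫_ℝ : ℂ)
          = ((2 * π * ⟪ζ, e x⟫_ℝ : ℝ) : ℂ) * Complex.I by push_cast; ring,
          Complex.norm_exp_ofReal_mul_I]
  have hιc : Continuous ι := ι.continuous_of_finiteDimensional
  have hemb : Topology.IsClosedEmbedding fun u : U => x + ι u :=
    (Homeomorph.addLeft x).isClosedEmbedding.comp
      (LinearMap.isClosedEmbedding_of_injective (LinearMap.ker_eq_bot.2 hι))
  have hgint : Integrable fun u : U => a (x + ι u) :=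
    Continuous.integrable_of_hasCompactSupport (by fun_prop) (hac.comp_isClosedEmbedding hemb)
  have hmain := integral_fresnel_mul_superposition hGx hθ hgint (fun u => by
    rw [hinv]
    refine integral_congr_ae (ae_of_all _ fun ζ => ?_)
    simp only
    rw [← mul_assoc, ← Complex.exp_add, map_add, inner_add_right, hθdef,
      LinearMap.adjoint_inner_left]
    simp only [hL, LinearMap.comp_apply]
    congr 2
    push_cast
    ring_nf
    rfl) hlpos
  have hlhs : (∫ u : U, Complex.exp (Complex.I * (lam / 2 * ‖u‖ ^ 2 : ℝ)) * a (x + ι u))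
      = ∫ u : U, Complex.exp (-((0 : ℝ) - Complex.I * (lam / 2 : ℝ)) * ‖u‖ ^ 2) * a (x + ι u) := by
    refine integral_congr_ae (ae_of_all _ fun u => ?_)
    simp only
    congr 2
    push_cast
    ring
  rw [hlhs, hmain, hinv x, ← mul_sub, norm_mul, mul_comm]
  refine mul_le_mul_of_nonneg_right ?_ (norm_nonneg _)
  refine le_trans ?_ (hl0 lam ((le_max_left _ _).trans hlam))
  rw [← integral_sub _ hGx]
  · refine (norm_integral_le_integral_norm _).trans (le_of_eq ?_)
    refine integral_congr_ae (ae_of_all _ fun ζ => ?_)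
    simp only
    rw [← sub_one_mul, norm_mul, norm_mul,
      show 2 * (π : ℂ) * Complex.I * (⟪ζ, e x⟫_ℝ : ℂ)
          = ((2 * π * ⟪ζ, e x⟫_ℝ : ℝ) : ℂ) * Complex.I by push_cast; ring,
          Complex.norm_exp_ofReal_mul_I, one_mul]
  · refine hGx.bdd_mul (c := 1) (Measurable.aestronglyMeasurable (by fun_prop))
      (ae_of_all _ fun ζ => norm_cexp_fresnel_le_one le_rfl (sq_nonneg _))

section Weave

variable {κ τ : Type*}

/-- The vector whose coordinates along the two halves of the index set are `z.1` and `z.2`. -/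
def weave (σ : κ ⊕ κ ≃ τ) : ((κ → ℝ) × (κ → ℝ)) →ₗ[ℝ] (τ → ℝ) where
  toFun z := fun i => Sum.elim z.1 z.2 (σ.symm i)
  map_add' z w := by
    funext i
    rcases h : σ.symm i with k | k <;> simp [h]
  map_smul' t z := by
    funext i
    rcases h : σ.symm i with k | k <;> simp [h]

@[simp] theorem weave_inl (σ : κ ⊕ κ ≃ τ) (z : (κ → ℝ) × (κ → ℝ)) (j : κ) :
    weave σ z (σ (Sum.inl j)) = z.1 j := by
  simp [weave]

@[simp] theorem weave_inr (σ : κ ⊕ κ ≃ τ) (z : (κ → ℝ) × (κ → ℝ)) (j : κ) :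
    weave σ z (σ (Sum.inr j)) = z.2 j := by
  simp [weave]

theorem weave_halves (σ : κ ⊕ κ ≃ τ) (y : τ → ℝ) :
    weave σ (fun j => y (σ (Sum.inl j)), fun j => y (σ (Sum.inr j))) = y := by
  funext i
  obtain ⟨k | k, rfl⟩ := σ.surjective i <;> simp

theorem weave_injective (σ : κ ⊕ κ ≃ τ) : Function.Injective (weave σ) := by
  intro z w h
  ext j
  · simpa using congrFun h (σ (Sum.inl j))
  · simpa using congrFun h (σ (Sum.inr j))

variable [Fintype κ]

@[fun_prop]
theorem continuous_weave (σ : κ ⊕ κ ≃ τ) : Continuous (weave σ) :=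
  (weave σ).continuous_of_finiteDimensional

variable [Fintype τ]

theorem measurePreserving_weave (σ : κ ⊕ κ ≃ τ) :
    MeasurePreserving (weave σ) volume volume := by
  have h := (volume_measurePreserving_piCongrLeft (fun _ : τ => ℝ) σ).comp
    (volume_measurePreserving_sumPiEquivProdPi_symm fun _ : κ ⊕ κ => ℝ)
  convert h using 1
  funext z i
  obtain ⟨k | k, rfl⟩ := σ.surjective i
  · rw [weave_inl, Function.comp_apply, MeasurableEquiv.coe_piCongrLeft,
      Equiv.piCongrLeft_apply_apply]
    rfl
  · rw [weave_inr, Function.comp_apply, MeasurableEquiv.coe_piCongrLeft,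
      Equiv.piCongrLeft_apply_apply]
    rfl

theorem measurableEmbedding_weave (σ : κ ⊕ κ ≃ τ) : MeasurableEmbedding (weave σ) :=
  (LinearMap.isClosedEmbedding_of_injective
    (LinearMap.ker_eq_bot.2 (weave_injective σ))).measurableEmbedding

/-- The map `((s, P), W) ↦ ((P, W + sP), s)` which parametrises a neighbourhood of
`{x_{2j+2} = x_n x_{2j+1}}`. -/
theorem measurePreserving_shear (σ : κ ⊕ κ ≃ τ) :
    MeasurePreserving (fun z : (ℝ × (κ → ℝ)) × (κ → ℝ) =>
      (weave σ (z.1.2, z.2 + z.1.1 • z.1.2), z.1.1)) volume volume := by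
  have h1 : MeasurePreserving (fun z : (ℝ × (κ → ℝ)) × (κ → ℝ) =>
      (z.1, z.2 + z.1.1 • z.1.2)) volume volume := by
    refine (MeasurePreserving.id volume).skew_product
      (g := fun (a : ℝ × (κ → ℝ)) (w : κ → ℝ) => w + a.1 • a.2) (by fun_prop)
      (ae_of_all _ fun a => ?_)
    exact (measurePreserving_add_right volume (a.1 • a.2)).map_eq
  have h2 : MeasurePreserving (fun z : (ℝ × (κ → ℝ)) × (κ → ℝ) => (z.1.1, (z.1.2, z.2)))
      volume volume := volume_preserving_prodAssoc
  have h3 : MeasurePreserving (Prod.swap : ℝ × ((κ → ℝ) × (κ → ℝ)) → _) volume volume :=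
    Measure.measurePreserving_swap
  have h4 : MeasurePreserving (Prod.map (weave σ) (id : ℝ → ℝ)) volume volume :=
    (measurePreserving_weave σ).prod (MeasurePreserving.id volume)
  exact h4.comp (h3.comp (h2.comp h1))

/-- A `ρ`-neighbourhood of the variety `{x_{2j+2} = x_n x_{2j+1}}`, localised to scale `r`. -/
def shearBox (σ : κ ⊕ κ ≃ τ) (r ρ : ℝ) : Set ((τ → ℝ) × ℝ) :=
  {x | |x.2| ≤ r ∧ ‖fun j => x.1 (σ (Sum.inl j))‖ ≤ r ∧
    ‖fun j => x.1 (σ (Sum.inr j)) - x.2 * x.1 (σ (Sum.inl j))‖ ≤ ρ}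

theorem measurableSet_shearBox (σ : κ ⊕ κ ≃ τ) (r ρ : ℝ) : MeasurableSet (shearBox σ r ρ) := by
  have h1 : IsClosed {x : (τ → ℝ) × ℝ | |x.2| ≤ r} :=
    isClosed_le (by fun_prop) continuous_const
  have h2 : IsClosed {x : (τ → ℝ) × ℝ | ‖fun j => x.1 (σ (Sum.inl j))‖ ≤ r} :=
    isClosed_le (by fun_prop) continuous_const
  have h3 : IsClosed {x : (τ → ℝ) × ℝ |
      ‖fun j => x.1 (σ (Sum.inr j)) - x.2 * x.1 (σ (Sum.inl j))‖ ≤ ρ} :=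
    isClosed_le (by fun_prop) continuous_const
  exact (h1.inter (h2.inter h3)).measurableSet

theorem volume_shearBox (σ : κ ⊕ κ ≃ τ) {r ρ : ℝ} (hr : 0 ≤ r) (hρ : 0 ≤ ρ) :
    volume (shearBox σ r ρ)
      = ENNReal.ofReal (2 * r * (2 * r) ^ Fintype.card κ * (2 * ρ) ^ Fintype.card κ) := by
  rw [← (measurePreserving_shear σ).measure_preimage (measurableSet_shearBox σ r ρ).nullMeasurableSet]
  have h : (fun z : (ℝ × (κ → ℝ)) × (κ → ℝ) => (weave σ (z.1.2, z.2 + z.1.1 • z.1.2), z.1.1)) ⁻¹'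
      shearBox σ r ρ = (Metric.closedBall 0 r ×ˢ Metric.closedBall 0 r) ×ˢ Metric.closedBall 0 ρ := by
    ext ⟨⟨s, P⟩, W⟩
    simp [shearBox, and_assoc]
  rw [h, Measure.volume_eq_prod, Measure.prod_prod, Measure.volume_eq_prod, Measure.prod_prod,
    Real.volume_closedBall, Real.volume_pi_closedBall _ hr, Real.volume_pi_closedBall _ hρ,
    ← ENNReal.ofReal_mul (by positivity), ← ENNReal.ofReal_mul (by positivity)]

end Weave

/-- Bourgain's phase splits as a sum over pairs of coordinates. -/
theorem bourgainPhaseOdd_eq_sum (n : ℕ) (hn : 3 ≤ n)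
    (σ : Fin ((n - 1) / 2) ⊕ Fin ((n - 1) / 2) ≃ Fin (n - 1))
    (hl : ∀ j, (σ (Sum.inl j) : ℕ) = 2 * j) (hr : ∀ j, (σ (Sum.inr j) : ℕ) = 2 * j + 1)
    (x : (Fin (n - 1) → ℝ) × ℝ) (y : Fin (n - 1) → ℝ) :
    bourgainPhaseOdd n hn x y = ∑ j, (x.1 (σ (Sum.inl j)) * y (σ (Sum.inl j))
      + x.1 (σ (Sum.inr j)) * y (σ (Sum.inr j))
      + 1 / 2 * (y (σ (Sum.inl j)) + x.2 * y (σ (Sum.inr j))) ^ 2) := by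
  have h1 : ∀ j h, idx (n - 1) h (2 * ((j : Fin ((n - 1) / 2)) : ℕ)) = σ (Sum.inl j) := by
    intro j h
    ext
    rw [hl]
    exact Nat.mod_eq_of_lt (by omega)
  have h2 : ∀ j h, idx (n - 1) h (2 * ((j : Fin ((n - 1) / 2)) : ℕ) + 1) = σ (Sum.inr j) := by
    intro j h
    ext
    rw [hr]
    exact Nat.mod_eq_of_lt (by omega)
  rw [bourgainPhaseOdd, pairSum, ← σ.sum_comp, Fintype.sum_sum_type, Finset.sum_range,
    Finset.mul_sum, ← Finset.sum_add_distrib, ← Finset.sum_add_distrib]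
  refine Finset.sum_congr rfl fun j _ => ?_
  rw [h1, h2]
  ring

theorem exists_interleaving (n : ℕ) (hodd : Odd n) :
    ∃ σ : Fin ((n - 1) / 2) ⊕ Fin ((n - 1) / 2) ≃ Fin (n - 1),
      (∀ j, (σ (Sum.inl j) : ℕ) = 2 * j) ∧ ∀ j, (σ (Sum.inr j) : ℕ) = 2 * j + 1 := by
  obtain ⟨J, rfl⟩ := hodd
  let g : Fin ((2 * J + 1 - 1) / 2) ⊕ Fin ((2 * J + 1 - 1) / 2) → Fin (2 * J + 1 - 1) :=
    Sum.elim (fun j => ⟨2 * j, by omega⟩) (fun j => ⟨2 * j + 1, by omega⟩)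
  have hg : Function.Bijective g := by
    rw [Fintype.bijective_iff_injective_and_card]
    constructor
    · rintro (i | i) (j | j) h <;> simp [g, Fin.ext_iff] at h ⊢ <;> omega
    · simp
      omega
  exact ⟨Equiv.ofBijective g hg, fun j => rfl, fun j => rfl⟩

section LowerBound

variable {κ : Type*} [Fintype κ] {m : ℕ}

/-- The indicator of the set where the second half of the coordinates has size at most `r`. -/
def halfCutoff (σ : κ ⊕ κ ≃ Fin m) (r : ℝ) (y : Fin m → ℝ) : ℂ :=
  (Metric.closedBall (0 : κ → ℝ) r).indicator (fun _ => (1 : ℂ)) fun j => y (σ (Sum.inr j))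

theorem measurable_halfCutoff (σ : κ ⊕ κ ≃ Fin m) (r : ℝ) : Measurable (halfCutoff σ r) :=
  (measurable_const.indicator Metric.isClosed_closedBall.measurableSet).comp (by fun_prop)

theorem norm_halfCutoff_le (σ : κ ⊕ κ ≃ Fin m) (r : ℝ) (y : Fin m → ℝ) :
    ‖halfCutoff σ r y‖ ≤ 1 := by
  unfold halfCutoff
  exact (norm_indicator_le_norm_self _ _).trans norm_one.le

theorem continuous_bourgain_phase (σ : κ ⊕ κ ≃ Fin m)
    {ϕ : ((Fin m → ℝ) × ℝ) → (Fin m → ℝ) → ℝ}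
    (hϕ : ∀ x y, ϕ x y = ∑ j, (x.1 (σ (Sum.inl j)) * y (σ (Sum.inl j))
      + x.1 (σ (Sum.inr j)) * y (σ (Sum.inr j))
      + 1 / 2 * (y (σ (Sum.inl j)) + x.2 * y (σ (Sum.inr j))) ^ 2)) (x : (Fin m → ℝ) × ℝ) :
    Continuous (ϕ x) := by
  have : ϕ x = fun y => ∑ j, (x.1 (σ (Sum.inl j)) * y (σ (Sum.inl j))
      + x.1 (σ (Sum.inr j)) * y (σ (Sum.inr j))
      + 1 / 2 * (y (σ (Sum.inl j)) + x.2 * y (σ (Sum.inr j))) ^ 2) := funext (hϕ x)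
  rw [this]
  fun_prop

theorem oscIntP_halfCutoff (σ : κ ⊕ κ ≃ Fin m) {ϕ : ((Fin m → ℝ) × ℝ) → (Fin m → ℝ) → ℝ}
    {x : (Fin m → ℝ) × ℝ} (hϕ : Continuous (ϕ x))
    {a : (((Fin m → ℝ) × ℝ) × (Fin m → ℝ)) → ℂ} (ha : Continuous a) (hac : HasCompactSupport a)
    (lam r : ℝ) :
    IntegrableOn (fun q : κ → ℝ => ∫ p : κ → ℝ,
        Complex.exp (Complex.I * ((lam * ϕ x (weave σ (p, q)) : ℝ) : ℂ)) * a (x, weave σ (p, q)))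
      (Metric.closedBall 0 r) ∧
    oscIntP lam ϕ a (halfCutoff σ r) x
      = ∫ q in Metric.closedBall (0 : κ → ℝ) r, ∫ p : κ → ℝ,
        Complex.exp (Complex.I * ((lam * ϕ x (weave σ (p, q)) : ℝ) : ℂ))
          * a (x, weave σ (p, q)) := by
  set g : (Fin m → ℝ) → ℂ := fun y => Complex.exp (Complex.I * ((lam * ϕ x y : ℝ) : ℂ)) * a (x, y)
    with hg
  have hemb : Topology.IsClosedEmbedding fun y : Fin m → ℝ => (x, y) := by
    refine ⟨isEmbedding_prodMkRight x, ?_⟩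
    have : Set.range (fun y : Fin m → ℝ => (x, y)) = {x} ×ˢ Set.univ := by
      ext ⟨u, v⟩
      simp [eq_comm]
    rw [this]
    exact isClosed_singleton.prod isClosed_univ
  have hgi : Integrable g :=
    Continuous.integrable_of_hasCompactSupport (by fun_prop) (hac.comp_isClosedEmbedding hemb).mul_left
  have hgw : Integrable (fun z : (κ → ℝ) × (κ → ℝ) => g (weave σ z)) (volume.prod volume) :=
    (measurePreserving_weave σ).integrable_comp_of_integrable hgi
  refine ⟨hgw.integral_prod_right.integrableOn, ?_⟩
  have h1 : oscIntP lam ϕ a (halfCutoff σ r) x = ∫ z : (κ → ℝ) × (κ → ℝ),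
      (Set.univ ×ˢ Metric.closedBall (0 : κ → ℝ) r).indicator (fun z => g (weave σ z)) z := by
    unfold oscIntP
    rw [← (measurePreserving_weave σ).integral_comp (measurableEmbedding_weave σ)]
    refine integral_congr_ae (ae_of_all _ fun z => ?_)
    by_cases hz : z.2 ∈ Metric.closedBall (0 : κ → ℝ) r
    · simp only [halfCutoff, weave_inr]
      rw [Set.indicator_of_mem hz, Set.indicator_of_mem (Set.mk_mem_prod (Set.mem_univ _) hz),
        mul_one]
    · simp only [halfCutoff, weave_inr]
      rw [Set.indicator_of_notMem hz, Set.indicator_of_notMem (fun h => hz h.2), mul_zero]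
  rw [h1, integral_indicator (MeasurableSet.univ.prod Metric.isClosed_closedBall.measurableSet),
    Measure.volume_eq_prod, ← Measure.prod_restrict, Measure.restrict_univ, integral_prod_symm]
  rw [← Measure.restrict_univ (μ := (volume : Measure (κ → ℝ))), Measure.prod_restrict,
    Measure.restrict_univ]
  exact hgw.integrableOn

/-- Completing the square in the first half of the variables. -/
theorem integral_bourgain_phase_eq (σ : κ ⊕ κ ≃ Fin m)
    {ϕ : ((Fin m → ℝ) × ℝ) → (Fin m → ℝ) → ℝ}
    (hϕ : ∀ x y, ϕ x y = ∑ j, (x.1 (σ (Sum.inl j)) * y (σ (Sum.inl j))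
      + x.1 (σ (Sum.inr j)) * y (σ (Sum.inr j))
      + 1 / 2 * (y (σ (Sum.inl j)) + x.2 * y (σ (Sum.inr j))) ^ 2))
    (a : (((Fin m → ℝ) × ℝ) × (Fin m → ℝ)) → ℂ) (lam s : ℝ) (P W q : κ → ℝ) :
    ∫ p : κ → ℝ, Complex.exp (Complex.I *
        ((lam * ϕ (weave σ (P, W + s • P), s) (weave σ (p, q)) : ℝ) : ℂ))
        * a ((weave σ (P, W + s • P), s), weave σ (p, q))
      = Complex.exp (Complex.I * ((-(lam / 2 * ∑ j, P j ^ 2) : ℝ) : ℂ))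
        * Complex.exp (Complex.I * ((∑ j, lam * W j * q j : ℝ) : ℂ))
        * ∫ u : EuclideanSpace ℝ κ, Complex.exp (Complex.I * (lam / 2 * ‖u‖ ^ 2 : ℝ))
          * a (((weave σ (P, W + s • P), s), weave σ (-P - s • q, q))
            + ((0, 0), weave σ (u.ofLp, 0))) := by
  rw [← integral_const_mul, ← integral_add_right_eq_self _ (-P - s • q),
    ← (PiLp.volume_preserving_ofLp κ).integral_comp
      (MeasurableEquiv.toLp 2 _).symm.measurableEmbedding]
  refine integral_congr_ae (ae_of_all _ fun u => ?_)
  have hw : weave σ (u.ofLp + (-P - s • q), q)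
      = weave σ (-P - s • q, q) + weave σ (u.ofLp, 0) := by
    rw [← map_add]
    simp [add_comm]
  simp only [Prod.mk_add_mk, add_zero, ← hw]
  rw [← mul_assoc, ← Complex.exp_add, ← Complex.exp_add, ← mul_add, ← mul_add, ← Complex.ofReal_add,
    ← Complex.ofReal_add, hϕ, EuclideanSpace.real_norm_sq_eq]
  congr 4
  simp only [weave_inl, weave_inr, Finset.mul_sum, ← Finset.sum_add_distrib,
    ← Finset.sum_neg_distrib]
  refine Finset.sum_congr rfl fun j _ => ?_
  simp only [Pi.add_apply, Pi.sub_apply, Pi.neg_apply, Pi.smul_apply, smul_eq_mul]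
  ring

theorem exists_forall_norm_amplitude_sub_le (σ : κ ⊕ κ ≃ Fin m)
    {a : (((Fin m → ℝ) × ℝ) × (Fin m → ℝ)) → ℂ} (ha : Continuous a) {ε : ℝ} (hε : 0 < ε) :
    ∃ r : ℝ, 0 < r ∧ ∀ (s : ℝ) (P W w q : κ → ℝ), |s| ≤ r → ‖P‖ ≤ r → ‖W‖ ≤ r → ‖w‖ ≤ r →
      ‖q‖ ≤ r → ‖Complex.exp (Complex.I * ((∑ j, w j * q j : ℝ) : ℂ))
        * a ((weave σ (P, W + s • P), s), weave σ (-P - s • q, q)) - a ((0, 0), 0)‖ ≤ ε := by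
  set Φ : ((ℝ × (κ → ℝ)) × (κ → ℝ)) × ((κ → ℝ) × (κ → ℝ)) → ℂ := fun z =>
    Complex.exp (Complex.I * ((∑ j, z.2.1 j * z.2.2 j : ℝ) : ℂ))
        * a ((weave σ (z.1.1.2, z.1.2 + z.1.1.1 • z.1.1.2), z.1.1.1),
          weave σ (-z.1.1.2 - z.1.1.1 • z.2.2, z.2.2)) with hΦ
  have hc : Continuous Φ := by fun_prop
  have h0 : Φ 0 = a ((0, 0), 0) := by
    have : weave σ ((0 : κ → ℝ), (0 : κ → ℝ)) = 0 := (weave σ).map_zero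
    simp [hΦ, this]
  obtain ⟨δ, hδ, h⟩ := Metric.continuousAt_iff.1 hc.continuousAt ε hε
  refine ⟨δ / 2, by positivity, fun s P W w q hs hP hW hw hq => ?_⟩
  have := h (x := (((s, P), W), (w, q))) (by
    rw [dist_zero_right]
    refine lt_of_le_of_lt ?_ (half_lt_self hδ)
    simp only [Prod.norm_def, max_le_iff, Real.norm_eq_abs]
    exact ⟨⟨⟨hs, hP⟩, hW⟩, hw, hq⟩)
  rw [dist_eq_norm, h0] at this
  exact this.le

theorem exists_forall_le_norm_oscIntP (σ : κ ⊕ κ ≃ Fin m)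
    {ϕ : ((Fin m → ℝ) × ℝ) → (Fin m → ℝ) → ℝ}
    (hϕ : ∀ x y, ϕ x y = ∑ j, (x.1 (σ (Sum.inl j)) * y (σ (Sum.inl j))
      + x.1 (σ (Sum.inr j)) * y (σ (Sum.inr j))
      + 1 / 2 * (y (σ (Sum.inl j)) + x.2 * y (σ (Sum.inr j))) ^ 2))
    {a : (((Fin m → ℝ) × ℝ) × (Fin m → ℝ)) → ℂ} (ha : ContDiff ℝ (⊤ : ℕ∞) a)
    (hac : HasCompactSupport a) (ha0 : a ((0, 0), 0) ≠ 0) :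
    ∃ r : ℝ, 0 < r ∧ ∃ lam₀ : ℝ, 1 ≤ lam₀ ∧ ∀ lam, lam₀ ≤ lam → ∀ x ∈ shearBox σ r (r / lam),
      (2 * r) ^ Fintype.card κ * (2 * π / lam) ^ (Fintype.card κ / 2 : ℝ)
        * (‖a ((0, 0), 0)‖ / 2) ≤ ‖oscIntP lam ϕ a (halfCutoff σ r) x‖ := by
  set α := a ((0, 0), 0)
  have hε : 0 < ‖α‖ / 4 := by positivity
  obtain ⟨r, hr, hamp⟩ := exists_forall_norm_amplitude_sub_le σ ha.continuous hε
  let ι : EuclideanSpace ℝ κ →ₗ[ℝ] (((Fin m → ℝ) × ℝ) × (Fin m → ℝ)) :=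
    LinearMap.inr ℝ ((Fin m → ℝ) × ℝ) (Fin m → ℝ) ∘ₗ weave σ ∘ₗ
      LinearMap.inl ℝ (κ → ℝ) (κ → ℝ) ∘ₗ (WithLp.linearEquiv 2 ℝ (κ → ℝ)).toLinearMap
  have hι : Function.Injective ι :=
    LinearMap.inr_injective.comp ((weave_injective σ).comp
      (LinearMap.inl_injective.comp (WithLp.linearEquiv 2 ℝ (κ → ℝ)).injective))
  obtain ⟨lam₁, -, hfres⟩ := exists_forall_norm_fresnel_sub_le ha hac hι hε
  refine ⟨r, hr, max lam₁ 1, le_max_right _ _, fun lam hlam x hx => ?_⟩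
  have hlam1 : 1 ≤ lam := (le_max_right _ _).trans hlam
  have hlpos : 0 < lam := one_pos.trans_le hlam1
  obtain ⟨K, hK, hfres⟩ := hfres lam ((le_max_left _ _).trans hlam)
  rw [finrank_euclideanSpace] at hK
  obtain ⟨s, P, W, rfl, hs, hP, hW⟩ : ∃ (s : ℝ) (P W : κ → ℝ), x = (weave σ (P, W + s • P), s) ∧
      |s| ≤ r ∧ ‖P‖ ≤ r ∧ ‖W‖ ≤ r / lam := by
    refine ⟨x.2, fun j => x.1 (σ (Sum.inl j)),
      fun j => x.1 (σ (Sum.inr j)) - x.2 * x.1 (σ (Sum.inl j)), ?_, hx⟩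
    refine Prod.ext ?_ rfl
    conv_lhs => rw [← weave_halves σ x.1]
    congr 2
    funext j
    simp
  have hWr : ‖W‖ ≤ r := hW.trans (div_le_self hr.le hlam1)
  have hwr : ‖lam • W‖ ≤ r := by
    rw [norm_smul, Real.norm_of_nonneg hlpos.le, mul_comm]
    exact (le_div_iff₀ hlpos).1 hW
  obtain ⟨hint, hosc⟩ := oscIntP_halfCutoff σ
    (continuous_bourgain_phase σ hϕ (weave σ (P, W + s • P), s)) ha.continuous hac lam r
  set I : (κ → ℝ) → ℂ := fun q => ∫ p : κ → ℝ, Complex.exp (Complex.I *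
        ((lam * ϕ (weave σ (P, W + s • P), s) (weave σ (p, q)) : ℝ) : ℂ))
        * a ((weave σ (P, W + s • P), s), weave σ (p, q)) with hI
  set ω : ℂ := Complex.exp (Complex.I * ((-(lam / 2 * ∑ j, P j ^ 2) : ℝ) : ℂ)) with hω
  have hunit : ∀ t : ℝ, ‖Complex.exp (Complex.I * (t : ℂ))‖ = 1 := fun t => by
    rw [mul_comm, Complex.norm_exp_ofReal_mul_I]
  have hbound : ∀ q ∈ Metric.closedBall (0 : κ → ℝ) r, ‖I q - ω * K * α‖ ≤ ‖K‖ * (‖α‖ / 2) := by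
    intro q hq
    have hq' : ‖q‖ ≤ r := by simpa using hq
    have h1 := hfres ((weave σ (P, W + s • P), s), weave σ (-P - s • q, q))
    have h2 := hamp s P W (lam • W) q hs hP hWr hwr hq'
    have h3 := integral_bourgain_phase_eq σ hϕ a lam s P W q
    set F := ∫ u : EuclideanSpace ℝ κ, Complex.exp (Complex.I * (lam / 2 * ‖u‖ ^ 2 : ℝ))
          * a (((weave σ (P, W + s • P), s), weave σ (-P - s • q, q))
            + ((0, 0), weave σ (u.ofLp, 0))) with hF
    set A := a ((weave σ (P, W + s • P), s), weave σ (-P - s • q, q))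
    set ψ : ℂ := Complex.exp (Complex.I * ((∑ j, lam * W j * q j : ℝ) : ℂ)) with hψ
    have h1' : ‖F - K * A‖ ≤ ‖α‖ / 4 * ‖K‖ := h1
    have h2' : ‖ψ * A - α‖ ≤ ‖α‖ / 4 := h2
    have h4 : I q - ω * K * α = ω * (ψ * (F - K * A) + K * (ψ * A - α)) := by
      simp only [hI]
      rw [h3]
      ring
    rw [h4, norm_mul, hω, hunit, one_mul]
    refine (norm_add_le _ _).trans ?_
    rw [norm_mul, norm_mul, hψ, hunit, one_mul]
    have := mul_le_mul_of_nonneg_left h2' (norm_nonneg K)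
    linarith
  have hvol : volume.real (Metric.closedBall (0 : κ → ℝ) r) = (2 * r) ^ Fintype.card κ := by
    rw [Measure.real, Real.volume_pi_closedBall _ hr.le, ENNReal.toReal_ofReal (by positivity)]
  have hfin : volume (Metric.closedBall (0 : κ → ℝ) r) < ∞ :=
    (isCompact_closedBall _ _).measure_lt_top
  have hdiff := norm_setIntegral_le_of_norm_le_const hfin hbound
  rw [integral_sub hint (integrableOn_const hfin.ne), setIntegral_const, hvol, ← hosc] at hdiff
  have hmain : ‖((2 * r) ^ Fintype.card κ : ℝ) • (ω * K * α)‖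
      = (2 * r) ^ Fintype.card κ * (‖K‖ * ‖α‖) := by
    rw [norm_smul, norm_mul, norm_mul, hω, hunit, one_mul, Real.norm_of_nonneg (by positivity)]
  have htri := norm_sub_norm_le (((2 * r) ^ Fintype.card κ : ℝ) • (ω * K * α))
    (oscIntP lam ϕ a (halfCutoff σ r) (weave σ (P, W + s • P), s))
  rw [norm_sub_rev, hmain] at htri
  rw [← hK]
  linarith

end LowerBound

end BourgainCounterexample

/-- Bourgain's counterexample, odd dimensions: for odd `n ≥ 3` and any
amplitude `a ∈ C_c^∞` supported in a sufficiently small neighbourhood of the origin with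
`a(0;0) ≠ 0`, for every `p ≥ 2` there are `c > 0` and `λ₀ ≥ 1` such that for every
`λ ≥ λ₀` some bounded measurable `f` with `‖f‖_∞ ≤ 1` satisfies
`‖T_λ f‖_{L^p(ℝⁿ)} ≥ c λ^{−(n−1)/4 − (n−1)/(2p)}`. -/
theorem bourgain_counterexample_odd (n : ℕ) (hn : 3 ≤ n) (hodd : Odd n) :
    ∃ δ₀ : ℝ, 0 < δ₀ ∧
      ∀ a : (((Fin (n - 1) → ℝ) × ℝ) × (Fin (n - 1) → ℝ)) → ℂ,
        ContDiff ℝ (⊤ : ℕ∞) a → HasCompactSupport a →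
        tsupport a ⊆ Metric.ball 0 δ₀ → a ((0, 0), 0) ≠ 0 →
        ∀ p : ℝ, 2 ≤ p →
          ∃ c : ℝ, 0 < c ∧ ∃ lam₀ : ℝ, 1 ≤ lam₀ ∧
            ∀ lam : ℝ, lam₀ ≤ lam →
              ∃ f : (Fin (n - 1) → ℝ) → ℂ, Measurable f ∧ (∀ y, ‖f y‖ ≤ 1) ∧
                ENNReal.ofReal
                    (c * lam ^ (-(((n : ℝ) - 1) / 4) - ((n : ℝ) - 1) / (2 * p)))
                  ≤ eLpNorm (oscIntP lam (bourgainPhaseOdd n hn) a f)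
                      (ENNReal.ofReal p) volume := by
  obtain ⟨σ, hl, hr⟩ := exists_interleaving n hodd
  obtain ⟨J, hJ⟩ : ∃ J, J = (n - 1) / 2 := ⟨_, rfl⟩
  have hJn : 2 * (J : ℝ) = (n : ℝ) - 1 := by
    obtain ⟨k, rfl⟩ := hodd
    simp [hJ]
  refine ⟨1, one_pos, fun a ha hac _ ha0 p hp => ?_⟩
  obtain ⟨r, hrpos, lam₀, hlam₀, hmain⟩ := exists_forall_le_norm_oscIntP σ
    (bourgainPhaseOdd_eq_sum n hn σ hl hr) ha hac ha0
  simp only [Fintype.card_fin] at hmain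
  have hppos : 0 < p := by linarith
  refine ⟨(2 * r) ^ J * (2 * Real.pi) ^ (J / 2 : ℝ) * (‖a ((0, 0), 0)‖ / 2)
      * (2 * r * (2 * r) ^ J * (2 * r) ^ J) ^ (1 / p),
    by positivity, lam₀, hlam₀, fun lam hlam => ?_⟩
  have hlpos : 0 < lam := by linarith
  refine ⟨halfCutoff σ r, measurable_halfCutoff σ r, norm_halfCutoff_le σ r, ?_⟩
  set C := (2 * r) ^ J * (2 * Real.pi / lam) ^ (J / 2 : ℝ) * (‖a ((0, 0), 0)‖ / 2) with hC
  have hCpos : 0 ≤ C := by positivity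
  have hle : eLpNorm ((shearBox σ r (r / lam)).indicator fun _ => C) (ENNReal.ofReal p) volume
      ≤ eLpNorm (oscIntP lam (bourgainPhaseOdd n hn) a (halfCutoff σ r)) (ENNReal.ofReal p)
        volume := by
    refine eLpNorm_mono fun x => ?_
    rw [norm_indicator_eq_indicator_norm, Real.norm_of_nonneg hCpos]
    exact Set.indicator_le' (fun x hx => by rw [hC, hJ]; exact hmain lam hlam x hx) (fun x _ => norm_nonneg _) x
  refine le_trans (le_of_eq ?_) hle
  rw [eLpNorm_indicator_const (measurableSet_shearBox σ r _) (by simpa using hppos)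
    ENNReal.ofReal_ne_top, volume_shearBox σ hrpos.le (by positivity), Fintype.card_fin, ← hJ,
    ENNReal.toReal_ofReal hppos.le, ENNReal.ofReal_rpow_of_nonneg (by positivity) (by positivity),
    Real.enorm_of_nonneg hCpos, ← ENNReal.ofReal_mul hCpos]
  congr 1
  have h1 : (2 * Real.pi / lam) ^ (J / 2 : ℝ)
      = (2 * Real.pi) ^ (J / 2 : ℝ) * lam ^ (-(J / 2 : ℝ)) := by
    rw [Real.div_rpow (by positivity) hlpos.le, Real.rpow_neg hlpos.le, div_eq_mul_inv]
  have h2 : (2 * r * (2 * r) ^ J * (2 * (r / lam)) ^ J) ^ (1 / p)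
      = (2 * r * (2 * r) ^ J * (2 * r) ^ J) ^ (1 / p) * lam ^ (-(J / p)) := by
    have h3 : (2 * (r / lam)) ^ J = (2 * r) ^ J * lam ^ (-(J : ℝ)) := by
      rw [Real.rpow_neg hlpos.le, Real.rpow_natCast, ← mul_div_assoc, div_pow, div_eq_mul_inv]
    rw [h3, ← mul_assoc, Real.mul_rpow (by positivity) (by positivity), ← Real.rpow_mul hlpos.le]
    congr 2
    ring
  have h4 : lam ^ (-(((n : ℝ) - 1) / 4) - ((n : ℝ) - 1) / (2 * p))
      = lam ^ (-(J / 2 : ℝ)) * lam ^ (-(J / p)) := by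
    rw [← Real.rpow_add hlpos, ← hJn]
    congr 1
    field_simp
    ring
  rw [hC, h1, h2, h4]
  ring
end
end

section
/- (Bourgain's counterexample, even dimensions.) Let n ≥ 4 be even, write x = (x′, x_n) ∈ ℝ^{n−1}×ℝ, and define the phase ϕ(x;y′) := ⟨x′, y′⟩ + (1/2) ∑_{j=0}^{(n−4)/2} ( y²_{2j+1} + 2 x_n y_{2j+1} y_{2j+2} + x_n² y²_{2j+2} ) + (1/2)(1 + x_n) y²_{n−1} on ℝⁿ×ℝ^{n−1}. Let a ∈ C_c^∞(ℝⁿ×ℝ^{n−1}) be supported in a sufficiently small neighbourhood of the origin with a(0;0) ≠ 0, and set T_λ f(x) := ∫_{ℝ^{n−1}} e^{iλϕ(x;y′)} a(x;y′) f(y′) dy′. Then for every p ≥ 2 there exist c > 0 and λ₀ ≥ 1 such that for every λ ≥ λ₀ there is a nonzero f ∈ S(ℝ^{n−1}) with ‖T_λ f‖_{L^p(ℝⁿ)} ≥ c λ^{−n/4 − (n−2)/(2p)} ‖f‖_{L^p(ℝ^{n−1})}. -/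
open MeasureTheory
open scoped ENNReal

noncomputable section

/-- Bourgain's phase in even dimensions:
`ϕ(x;y′) = ⟨x′,y′⟩ + (1/2)∑_{j=0}^{(n−4)/2}(y²_{2j+1} + 2x_n y_{2j+1}y_{2j+2} + x_n² y²_{2j+2})
+ (1/2)(1+x_n)y²_{n−1}`, where `x = (x′,x_n) ∈ ℝ^{n−1} × ℝ`. -/
def bourgainPhaseEven (n : ℕ) (hn : 4 ≤ n) (x : (Fin (n - 1) → ℝ) × ℝ)
    (y : Fin (n - 1) → ℝ) : ℝ :=
  (∑ j : Fin (n - 1), x.1 j * y j)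
    + (1 / 2) * pairSum (n - 1) (by omega) ((n - 2) / 2) x.2 y
    + (1 / 2) * (1 + x.2) * (y (idx (n - 1) (by omega) (n - 2))) ^ 2

theorem exists_fourier_representation {X ι : Type*} [NormedAddCommGroup X] [NormedSpace ℝ X]
    [FiniteDimensional ℝ X] [Fintype ι] [DecidableEq ι] {H : X × (ι → ℝ) → ℂ}
    (hs : ContDiff ℝ (⊤ : ℕ∞) H) (hc : HasCompactSupport H) :
    ∃ (d : ℕ) (h : EuclideanSpace ℝ (Fin d) → ℂ) (q : EuclideanSpace ℝ (Fin d) → X → ℝ)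
      (η : EuclideanSpace ℝ (Fin d) → ι → ℝ),
      Integrable h ∧ (∀ ξ, Continuous (q ξ)) ∧ (∀ x, Continuous fun ξ => q ξ x) ∧
      (∀ ξ, q ξ 0 = 0) ∧ Continuous η ∧
      ∀ x z, H (x, z) =
        ∫ ξ, h ξ * Complex.exp (Complex.I * ((q ξ x + ∑ i, η ξ i * z i : ℝ) : ℂ)) := by
  let L := toEuclidean (E := X × (ι → ℝ))
  let G : SchwartzMap (EuclideanSpace ℝ (Fin (Module.finrank ℝ (X × (ι → ℝ))))) ℂ :=
    (hc.comp_homeomorph L.symm.toHomeomorph).toSchwartzMap (hs.comp L.symm.contDiff)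
  refine ⟨_, FourierTransform.fourier G, fun ξ x => 2 * Real.pi * inner ℝ ξ (L (x, 0)),
    fun ξ i => 2 * Real.pi * inner ℝ ξ (L (0, Pi.single i 1)), SchwartzMap.integrable _,
    fun ξ => by fun_prop, fun x => by fun_prop, fun ξ => ?_, by fun_prop, fun x z => ?_⟩
  · have : L (0, 0) = 0 := L.map_zero
    simp [this]
  · have hG : FourierTransformInv.fourierInv (FourierTransform.fourier G) (L (x, z))
        = G (L (x, z)) := by
      rw [FourierTransform.fourierInv_fourier_eq]
    have hGH : G (L (x, z)) = H (x, z) := congrArg H (L.symm_apply_apply (x, z))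
    rw [← hGH, ← hG, SchwartzMap.fourierInv_coe, Real.fourierInv_eq']
    refine integral_congr_ae (.of_forall fun ξ => ?_)
    have hz : L (x, z) = L (x, 0) + ∑ i, z i • L (0, Pi.single i 1) := by
      simp_rw [← map_smul, ← map_sum, ← map_add]
      congr 1
      refine Prod.ext ?_ ?_
      · simp [Prod.fst_sum]
      · simp only [Prod.snd_add, Prod.snd_sum, Prod.smul_snd, zero_add]
        exact pi_eq_sum_univ' z
    simp only [smul_eq_mul]
    rw [mul_comm, hz, inner_add_right, inner_sum]
    congr 2
    simp only [inner_smul_right]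
    rw [mul_comm]
    congr 2
    rw [mul_add, Finset.mul_sum]
    congr 1
    exact Finset.sum_congr rfl fun i _ => by ring

/-- The amplitude is a Gaussian times a superposition of characters, so each frequency contributes
an explicit Gaussian integral. -/
theorem integral_cexp_quadratic_mul_superposition {W ι : Type*} [Fintype ι] [TopologicalSpace W]
    [SecondCountableTopology W] [MeasurableSpace W] [BorelSpace W] {μ : Measure W} [SFinite μ]
    {h : W → ℂ} (hh : Integrable h μ) {q : W → ℝ} (hq : Continuous q) {η : W → ι → ℝ}
    (hη : Continuous η) (θ τ : ι → ℝ) :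
    ∫ z : ι → ℝ, Complex.exp (Complex.I * ((∑ i, (θ i * z i + τ i * z i ^ 2 / 2) : ℝ) : ℂ)) *
        (Complex.exp (((-∑ i, z i ^ 2 / 2 : ℝ)) : ℂ) *
          ∫ ξ, h ξ * Complex.exp (Complex.I * ((q ξ + ∑ i, η ξ i * z i : ℝ) : ℂ)) ∂μ) =
      (∏ i, ((Real.pi : ℂ) / ((1 - Complex.I * τ i) / 2)) ^ (1 / 2 : ℂ)) *
        ∫ ξ, h ξ * Complex.exp (Complex.I * (q ξ : ℂ)) *
          ∏ i, Complex.exp (-((θ i + η ξ i : ℂ) ^ 2 / (2 * (1 - Complex.I * τ i)))) ∂μ := by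
  have hint : Integrable (fun z : ι → ℝ => Complex.exp (((-∑ i, z i ^ 2 / 2 : ℝ)) : ℂ)) := by
    have := GaussianFourier.integrable_cexp_neg_sum_mul_add (ι := ι) (b := fun _ => (1 / 2 : ℂ))
      (fun _ => by norm_num) (fun _ => 0)
    refine this.congr (.of_forall fun z => ?_)
    simp only
    congr 1
    push_cast
    simp only [zero_mul, Finset.sum_const_zero, add_zero]
    congr 1
    exact Finset.sum_congr rfl fun i _ => by ring
  have hprod : Integrable (Function.uncurry fun (z : ι → ℝ) (ξ : W) =>
      Complex.exp (Complex.I * ((∑ i, (θ i * z i + τ i * z i ^ 2 / 2) : ℝ) : ℂ)) *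
        (Complex.exp (((-∑ i, z i ^ 2 / 2 : ℝ)) : ℂ) *
          (h ξ * Complex.exp (Complex.I * ((q ξ + ∑ i, η ξ i * z i : ℝ) : ℂ)))))
      (volume.prod μ) := by
    have h1 := hint.mul_prod hh
    have h2 := h1.bdd_mul (c := 1) (f := fun p : (ι → ℝ) × W =>
      Complex.exp (Complex.I * ((∑ i, (θ i * p.1 i + τ i * p.1 i ^ 2 / 2) : ℝ) : ℂ)) *
       Complex.exp (Complex.I * ((q p.2 + ∑ i, η p.2 i * p.1 i : ℝ) : ℂ)))
      (by
        apply Continuous.aestronglyMeasurable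
        have : ∀ i, Continuous fun ξ => η ξ i := fun i => (continuous_apply i).comp hη
        fun_prop)
      (.of_forall fun p => by
        rw [norm_mul, mul_comm Complex.I, mul_comm Complex.I, Complex.norm_exp_ofReal_mul_I,
          Complex.norm_exp_ofReal_mul_I, one_mul])
    refine h2.congr (.of_forall fun p => ?_)
    simp only [Function.uncurry]
    ring
  simp_rw [← integral_const_mul]
  rw [integral_integral_swap hprod]
  refine integral_congr_ae (.of_forall fun ξ => ?_)
  have hb : ∀ i, 0 < ((1 - Complex.I * τ i) / 2 : ℂ).re := fun i => by simp
  have key := GaussianFourier.integral_cexp_neg_sum_mul_add hb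
    (fun i => Complex.I * (θ i + η ξ i))
  have : ∀ z : ι → ℝ,
      Complex.exp (Complex.I * ((∑ i, (θ i * z i + τ i * z i ^ 2 / 2) : ℝ) : ℂ)) *
        (Complex.exp (((-∑ i, z i ^ 2 / 2 : ℝ)) : ℂ) *
          (h ξ * Complex.exp (Complex.I * ((q ξ + ∑ i, η ξ i * z i : ℝ) : ℂ)))) =
      h ξ * Complex.exp (Complex.I * (q ξ : ℂ)) *
        Complex.exp (-∑ i, ((1 - Complex.I * τ i) / 2 : ℂ) * (z i : ℂ) ^ 2 +
          ∑ i, Complex.I * (θ i + η ξ i) * z i) := by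
    intro z
    rw [mul_left_comm _ (h ξ), mul_left_comm _ (h ξ), mul_assoc (h ξ), ← Complex.exp_add,
      ← Complex.exp_add, ← Complex.exp_add]
    congr 2
    push_cast
    rw [← Finset.sum_neg_distrib, ← Finset.sum_neg_distrib]
    have hsum : ∑ i, (-((z i : ℂ) ^ 2 / 2)) + (∑ i, (η ξ i : ℂ) * z i) * Complex.I
        + Complex.I * ∑ i, (θ i * z i + τ i * (z i : ℂ) ^ 2 / 2) =
      ∑ i, -((1 - Complex.I * τ i) / 2 * (z i : ℂ) ^ 2)
        + ∑ i, Complex.I * (θ i + η ξ i) * z i := by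
      simp only [Finset.mul_sum, Finset.sum_mul, ← Finset.sum_add_distrib]
      exact Finset.sum_congr rfl fun i _ => by ring
    linear_combination hsum
  simp_rw [this]
  rw [integral_const_mul, key, Finset.prod_mul_distrib, mul_left_comm]
  congr 2
  refine Finset.prod_congr rfl fun i _ => ?_
  congr 1
  rw [mul_pow, Complex.I_sq, ← neg_div]
  congr 1 <;> ring

/-- Integrating out the frequencies against a product of point masses and standard Gaussians. -/
theorem integral_superposition_pi {W ι : Type*} [Fintype ι] [DecidableEq ι] [TopologicalSpace W]
    [SecondCountableTopology W] [MeasurableSpace W] [BorelSpace W] {μ : Measure W} [SFinite μ]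
    {h : W → ℂ} (hh : Integrable h μ) {η : W → ι → ℝ} (hη : Continuous η) (D : Finset ι) :
    ∫ z : ι → ℝ, (∫ ξ, h ξ * Complex.exp (Complex.I * ((∑ i, η ξ i * z i : ℝ) : ℂ)) ∂μ)
        ∂(Measure.pi fun i => if i ∈ D then Measure.dirac (0 : ℝ)
          else ProbabilityTheory.gaussianReal 0 1) =
      ∫ ξ, h ξ * ∏ i, (if i ∈ D then 1 else Complex.exp (-((η ξ i : ℂ) ^ 2 / 2))) ∂μ := by
  set ν : ι → Measure ℝ := fun i => if i ∈ D then Measure.dirac (0 : ℝ)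
    else ProbabilityTheory.gaussianReal 0 1 with hν
  have : ∀ i, IsProbabilityMeasure (ν i) := fun i => by
    simp only [hν]; split_ifs <;> infer_instance
  have hprod : Integrable (Function.uncurry fun (z : ι → ℝ) (ξ : W) =>
      h ξ * Complex.exp (Complex.I * ((∑ i, η ξ i * z i : ℝ) : ℂ)))
      ((Measure.pi ν).prod μ) := by
    refine ((hh.comp_snd (Measure.pi ν)).bdd_mul (c := 1) (f := fun p : (ι → ℝ) × W =>
       Complex.exp (Complex.I * ((∑ i, η p.2 i * p.1 i : ℝ) : ℂ)))
      (by
        apply Continuous.aestronglyMeasurable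
        have : ∀ i, Continuous fun ξ => η ξ i := fun i => (continuous_apply i).comp hη
        fun_prop)
      (.of_forall fun p => by
        rw [mul_comm Complex.I, Complex.norm_exp_ofReal_mul_I])).congr (.of_forall fun p => ?_)
    simp only [Function.uncurry]
    ring
  rw [integral_integral_swap hprod]
  refine integral_congr_ae (.of_forall fun ξ => ?_)
  simp only
  rw [integral_const_mul]
  congr 1
  have : ∀ z : ι → ℝ, Complex.exp (Complex.I * ((∑ i, η ξ i * z i : ℝ) : ℂ)) =
      ∏ i, Complex.exp (η ξ i * z i * Complex.I) := by
    intro z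
    rw [← Complex.exp_sum, mul_comm, ← Finset.sum_mul]
    push_cast
    rfl
  simp_rw [this]
  rw [integral_fintype_prod_eq_prod (μ := ν) (f := fun i (t : ℝ) =>
    Complex.exp (η ξ i * t * Complex.I))]
  refine Finset.prod_congr rfl fun i _ => ?_
  rw [← charFun_apply_real]
  simp only [hν]
  split_ifs
  · simp [charFun_dirac]
  · rw [ProbabilityTheory.charFun_gaussianReal]
    congr 1
    simp

/-- The Gaussian factor `exp(-(θ+η)²/(2(1-iτ)))`, multiplied by the unimodular number
`exp(iθ²/(2τ))`. -/
def gaussFactor (θ τ η : ℝ) : ℂ :=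
  Complex.exp (Complex.I * ((θ ^ 2 / (2 * τ) : ℝ) : ℂ)) *
    Complex.exp (-((θ + η : ℂ) ^ 2 / (2 * (1 - Complex.I * τ))))

theorem norm_gaussFactor_le_one (θ τ η : ℝ) : ‖gaussFactor θ τ η‖ ≤ 1 := by
  rw [gaussFactor, norm_mul, mul_comm Complex.I, Complex.norm_exp_ofReal_mul_I, one_mul,
    Complex.norm_exp, Real.exp_le_one_iff]
  have h : -((θ + η : ℂ) ^ 2 / (2 * (1 - Complex.I * τ))) =
      (((-((θ + η) ^ 2 / 2) : ℝ)) : ℂ) * (1 - Complex.I * τ)⁻¹ := by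
    push_cast
    rw [div_mul_eq_div_div]
    ring
  rw [h, Complex.re_ofReal_mul, Complex.inv_re]
  have h1 : (1 - Complex.I * τ : ℂ).re = 1 := by simp
  rw [h1]
  exact mul_nonpos_of_nonpos_of_nonneg (by nlinarith [sq_nonneg (θ + η)])
    (div_nonneg zero_le_one (Complex.normSq_nonneg _))

theorem continuous_gaussFactor (θ τ : ℝ) : Continuous (gaussFactor θ τ) := by
  unfold gaussFactor
  fun_prop

theorem gaussFactor_zero (θ η : ℝ) :
    gaussFactor θ 0 η = Complex.exp (-((θ + η : ℂ) ^ 2 / 2)) := by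
  simp [gaussFactor]

theorem tendsto_gaussFactor_mul {α : Type*} {l : Filter α} {Λ β γ : α → ℝ}
    (hΛ : Filter.Tendsto Λ l Filter.atTop) (hβ : Filter.Tendsto β l (nhds 0))
    (hγ : Filter.Tendsto γ l (nhds 1)) (η : ℝ) :
    Filter.Tendsto (fun a => gaussFactor (Λ a * β a) (Λ a * γ a) η) l (nhds 1) := by
  have hβ' : Filter.Tendsto (fun a => (β a : ℂ)) l (nhds ((0 : ℝ) : ℂ)) :=
    (Complex.continuous_ofReal.tendsto 0).comp hβ
  have hγ' : Filter.Tendsto (fun a => (γ a : ℂ)) l (nhds ((1 : ℝ) : ℂ)) :=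
    (Complex.continuous_ofReal.tendsto 1).comp hγ
  have hΛ' : Filter.Tendsto (fun a => (((Λ a)⁻¹ : ℝ) : ℂ)) l (nhds ((0 : ℝ) : ℂ)) :=
    (Complex.continuous_ofReal.tendsto 0).comp (tendsto_inv_atTop_zero.comp hΛ)
  have hκ : Filter.Tendsto (fun a => ((((Λ a)⁻¹ : ℝ) : ℂ) - Complex.I * γ a)⁻¹) l
      (nhds ((((0 : ℝ) : ℂ) - Complex.I * ((1 : ℝ) : ℂ))⁻¹)) :=
    (hΛ'.sub (hγ'.const_mul _)).inv₀ (by simp)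
  have hlim := ((((hβ'.mul_const (η : ℂ)).mul hκ).neg.sub
    ((hΛ'.mul hκ).mul_const ((η : ℂ) ^ 2 / 2))).add
    ((((hβ'.pow 2).const_mul Complex.I).mul hκ).div (hγ'.const_mul 2) (by simp))).cexp
  have h0 : Complex.exp (-(((0 : ℝ) : ℂ) * η * (((0 : ℝ) : ℂ) - Complex.I * ((1 : ℝ) : ℂ))⁻¹) -
      ((0 : ℝ) : ℂ) * (((0 : ℝ) : ℂ) - Complex.I * ((1 : ℝ) : ℂ))⁻¹ * ((η : ℂ) ^ 2 / 2) +
      Complex.I * ((0 : ℝ) : ℂ) ^ 2 * (((0 : ℝ) : ℂ) - Complex.I * ((1 : ℝ) : ℂ))⁻¹ /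
        (2 * ((1 : ℝ) : ℂ))) = 1 := by simp
  rw [h0] at hlim
  refine hlim.congr' ?_
  filter_upwards [hΛ.eventually_gt_atTop 0, hγ.eventually (lt_mem_nhds zero_lt_one)] with a ha hg
  rw [gaussFactor, ← Complex.exp_add]
  congr 1
  have h1 : (Λ a : ℂ) ≠ 0 := by exact_mod_cast ha.ne'
  have h2 : (γ a : ℂ) ≠ 0 := by exact_mod_cast hg.ne'
  have h3 : (1 - Complex.I * (Λ a * γ a) : ℂ) ≠ 0 := fun h => by
    have := congrArg Complex.re h
    simp at this
  have h4 : (((Λ a)⁻¹ : ℝ) : ℂ) - Complex.I * γ a =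
      (1 - Complex.I * (Λ a * γ a)) / Λ a := by
    push_cast
    field_simp
  simp only [Pi.div_apply]
  rw [h4]
  push_cast
  have h5 : (1 - Complex.I * Λ a * γ a : ℂ) ≠ 0 := by rwa [mul_assoc]
  field_simp
  ring_nf
  simp only [Complex.I_sq]
  ring

theorem tendsto_integral_gaussFactor {W X ι α : Type*} [Fintype ι] [DecidableEq ι]
    [TopologicalSpace W] [SecondCountableTopology W] [MeasurableSpace W] [BorelSpace W]
    {μ : Measure W} [TopologicalSpace X] [Zero X] {l : Filter α} [l.IsCountablyGenerated]
    {h : W → ℂ} (hh : Integrable h μ) {q : W → X → ℝ} (hq : ∀ ξ, Continuous (q ξ))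
    (hq' : ∀ x, Continuous fun ξ => q ξ x) (hq0 : ∀ ξ, q ξ 0 = 0) {η : W → ι → ℝ}
    (hη : Continuous η) (D : Finset ι) {Λ : α → ℝ} {x : α → X} {β γ : α → ι → ℝ}
    (hΛ : Filter.Tendsto Λ l Filter.atTop) (hx : Filter.Tendsto x l (nhds 0))
    (hβ : ∀ i ∈ D, Filter.Tendsto (fun a => β a i) l (nhds 0))
    (hγ : ∀ i ∈ D, Filter.Tendsto (fun a => γ a i) l (nhds 1))
    (hβ' : ∀ i ∉ D, Filter.Tendsto (fun a => Λ a * β a i) l (nhds 0))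
    (hγ' : ∀ i ∉ D, ∀ a, γ a i = 0) :
    Filter.Tendsto (fun a => ∫ ξ, h ξ * Complex.exp (Complex.I * (q ξ (x a) : ℂ)) *
        ∏ i, gaussFactor (Λ a * β a i) (Λ a * γ a i) (η ξ i) ∂μ) l
      (nhds (∫ ξ, h ξ *
        ∏ i, (if i ∈ D then 1 else Complex.exp (-((η ξ i : ℂ) ^ 2 / 2))) ∂μ)) := by
  refine tendsto_integral_filter_of_dominated_convergence (fun ξ => ‖h ξ‖)
    (.of_forall fun a => ?_) (.of_forall fun a => .of_forall fun ξ => ?_) hh.norm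
    (.of_forall fun ξ => ?_)
  · have hq'' := hq' (x a)
    have : ∀ i, Continuous fun ξ => η ξ i := fun i => (continuous_apply i).comp hη
    refine (hh.1.mul (Continuous.aestronglyMeasurable (by fun_prop))).mul
      (Continuous.aestronglyMeasurable ?_)
    exact continuous_finsetProd _ fun i _ => (continuous_gaussFactor _ _).comp (this i)
  · rw [norm_mul, norm_mul, mul_comm Complex.I, Complex.norm_exp_ofReal_mul_I, mul_one, norm_prod]
    exact mul_le_of_le_one_right (norm_nonneg _)
      (Finset.prod_le_one (fun _ _ => norm_nonneg _) fun i _ => norm_gaussFactor_le_one _ _ _)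
  · refine Filter.Tendsto.mul ?_ (tendsto_finsetProd _ fun i _ => ?_)
    · have h1 : Filter.Tendsto (fun a => q ξ (x a)) l (nhds 0) := by
        simpa [hq0, Function.comp_def] using ((hq ξ).tendsto 0).comp hx
      simpa using ((((Complex.continuous_ofReal.tendsto 0).comp h1).const_mul
        Complex.I).cexp).const_mul (h ξ)
    · split_ifs with hi
      · exact tendsto_gaussFactor_mul hΛ (hβ i hi) (hγ i hi) _
      · simp only [hγ' i hi, mul_zero, gaussFactor_zero]
        have h1 := (Complex.continuous_ofReal.tendsto 0).comp (hβ' i hi)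
        simpa using ((((h1.add_const (η ξ i : ℂ)).pow 2).div_const 2).neg).cexp

theorem rpow_neg_half_le_norm_cpow {T τ : ℝ} (hT : 0 < T) (h : 1 + |τ| ≤ 6 * T) :
    T ^ (-(1 / 2 : ℝ)) ≤ ‖((Real.pi : ℂ) / ((1 - Complex.I * τ) / 2)) ^ (1 / 2 : ℂ)‖ := by
  have h1 : (1 / 2 : ℂ) = ((1 / 2 : ℝ) : ℂ) := by push_cast; rfl
  rw [h1, Complex.norm_cpow_real, Real.rpow_neg hT.le, ← Real.inv_rpow hT.le]
  refine Real.rpow_le_rpow (by positivity) ?_ (by norm_num)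
  have h2 : ‖(1 - Complex.I * τ : ℂ)‖ ≤ 1 + |τ| := by
    simpa using norm_sub_le (1 : ℂ) (Complex.I * τ)
  have h3 : 0 < ‖(1 - Complex.I * τ : ℂ)‖ := norm_pos_iff.2 fun h => by
    have := congrArg Complex.re h
    simp at this
  rw [norm_div, norm_div, Complex.norm_real, Complex.norm_ofNat, Real.norm_of_nonneg Real.pi_pos.le,
    inv_eq_one_div, div_le_div_iff₀ hT (by positivity)]
  nlinarith [Real.pi_gt_three]

theorem integral_pi_dirac_gaussian_ne_zero {ι : Type*} [Fintype ι] [DecidableEq ι] (D : Finset ι)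
    {g : (ι → ℝ) → ℂ} (hg : Continuous g) (hc : HasCompactSupport g) (hre : ∀ z, 0 ≤ (g z).re)
    (h0 : 0 < (g 0).re) :
    ∫ z, g z ∂(Measure.pi fun i => if i ∈ D then Measure.dirac (0 : ℝ)
      else ProbabilityTheory.gaussianReal 0 1) ≠ 0 := by
  set ν : ι → Measure ℝ := fun i => if i ∈ D then Measure.dirac (0 : ℝ)
    else ProbabilityTheory.gaussianReal 0 1 with hν
  have : ∀ i, IsProbabilityMeasure (ν i) := fun i => by
    simp only [hν]; split_ifs <;> infer_instance
  have hint : Integrable g (Measure.pi ν) := hg.integrable_of_hasCompactSupport hc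
  intro h
  have h1 : ∫ z, (g z).re ∂(Measure.pi ν) = 0 := by
    have := integral_re hint
    simp only [RCLike.re_to_complex] at this
    rw [this, h, Complex.zero_re]
  have h2 : 0 < ∫ z, (g z).re ∂(Measure.pi ν) := by
    rw [integral_pos_iff_support_of_nonneg hre hint.re]
    have hU : {z | 0 < (g z).re} ∈ nhds (0 : ι → ℝ) :=
      (isOpen_lt continuous_const (Complex.continuous_re.comp hg)).mem_nhds h0
    obtain ⟨r, hr, hsub⟩ := Metric.mem_nhds_iff.1 hU
    have hpos : 0 < Measure.pi ν (Metric.ball 0 r) := by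
      rw [ball_pi _ hr, Measure.pi_pi, pos_iff_ne_zero, Finset.prod_ne_zero_iff]
      intro i _
      simp only [hν]
      split_ifs
      · rw [Measure.dirac_apply_of_mem (by simpa using hr)]
        exact one_ne_zero
      · intro h3
        have := ProbabilityTheory.gaussianReal_absolutelyContinuous' 0 one_ne_zero h3
        exact (Metric.measure_ball_pos volume _ hr).ne' this
    refine hpos.trans_le (measure_mono fun z hz => ?_)
    exact (hsub hz).ne'
  exact h2.ne' h1

/-- The shear `(x, z) ↦ (x, z - c x • N z)` for a matrix `N` with `N² = 0`. -/
def skewShear {X ι : Type*} [Fintype ι] [TopologicalSpace X] {c : X → ℝ} (hc : Continuous c)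
    {N : Matrix ι ι ℝ} (hN : N * N = 0) : X × (ι → ℝ) ≃ₜ X × (ι → ℝ) where
  toFun p := (p.1, p.2 - c p.1 • N.mulVec p.2)
  invFun p := (p.1, p.2 + c p.1 • N.mulVec p.2)
  left_inv p := by
    simp [Matrix.mulVec_sub, Matrix.mulVec_smul, Matrix.mulVec_mulVec, hN]
  right_inv p := by
    simp [Matrix.mulVec_add, Matrix.mulVec_smul, Matrix.mulVec_mulVec, hN]
  continuous_toFun := by fun_prop
  continuous_invFun := by fun_prop

/-- The shear `z ↦ z - s • N z` for a matrix `N` with `N² = 0`. -/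
def shear {ι : Type*} [Fintype ι] (s : ℝ) {N : Matrix ι ι ℝ} (hN : N * N = 0) :
    (ι → ℝ) ≃ₜ (ι → ℝ) where
  toFun z := z - s • N.mulVec z
  invFun z := z + s • N.mulVec z
  left_inv z := by
    simp [Matrix.mulVec_sub, Matrix.mulVec_smul, Matrix.mulVec_mulVec, hN]
  right_inv z := by
    simp [Matrix.mulVec_add, Matrix.mulVec_smul, Matrix.mulVec_mulVec, hN]
  continuous_toFun := by fun_prop
  continuous_invFun := by fun_prop

theorem map_shear_volume {ι : Type*} [Fintype ι] [DecidableEq ι] {s : ℝ} {N : Matrix ι ι ℝ}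
    (hdet : (1 - s • N).det = 1) :
    Measure.map (fun z : ι → ℝ => z - s • N.mulVec z) volume = volume := by
  have h := Real.map_matrix_volume_pi_eq_smul_volume_pi (M := 1 - s • N) (by simp [hdet])
  have h1 : (⇑(Matrix.toLin' (1 - s • N)) : (ι → ℝ) → ι → ℝ) =
      fun z => z - s • N.mulVec z := by
    ext z
    simp
  rw [h1, hdet] at h
  simpa using h

theorem integral_comp_shear {ι : Type*} [Fintype ι] [DecidableEq ι] (s : ℝ) {N : Matrix ι ι ℝ}
    (hN : N * N = 0) (hdet : (1 - s • N).det = 1) (F : (ι → ℝ) → ℂ) :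
    ∫ z, F (z - s • N.mulVec z) = ∫ y, F y := by
  have h : MeasurePreserving (shear s hN) volume volume :=
    ⟨(shear s hN).continuous.measurable, map_shear_volume hdet⟩
  exact h.integral_comp (shear s hN).measurableEmbedding F

section ShearedPhase

variable {m : ℕ}

/-- A bump function whose product with the amplitude `a (0, ·)` has nonnegative real part after
multiplication by the conjugate of `a (0, 0)`. -/
theorem exists_bump_mul_amplitude {X ι : Type*} [Fintype ι] [TopologicalSpace X] [Zero X]
    {a : X × (ι → ℝ) → ℂ} (ha : Continuous a) (ha0 : a (0, 0) ≠ 0) :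
    ∃ f : SchwartzMap (ι → ℝ) ℂ, HasCompactSupport f ∧ f 0 = 1 ∧
      ∀ y, 0 ≤ ((starRingEnd ℂ) (a (0, 0)) * (a (0, y) * f y)).re := by
  have hcont : Continuous fun y : ι → ℝ => ((starRingEnd ℂ) (a (0, 0)) * a (0, y)).re := by fun_prop
  have h0 : 0 < ((starRingEnd ℂ) (a (0, 0)) * a (0, 0)).re := by
    rw [← Complex.normSq_eq_conj_mul_self, Complex.ofReal_re]
    exact Complex.normSq_pos.2 ha0
  obtain ⟨r, hr, hsub⟩ := Metric.mem_nhds_iff.1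
    ((isOpen_lt continuous_const hcont).mem_nhds (show (0 : ι → ℝ) ∈ {y | _ < _} from h0))
  let χ : ContDiffBump (0 : ι → ℝ) := ⟨r / 2, r, by positivity, by linarith⟩
  have hsupp : HasCompactSupport fun y => ((χ y : ℝ) : ℂ) :=
    χ.hasCompactSupport.comp_left (g := fun t : ℝ => (t : ℂ)) rfl
  refine ⟨hsupp.toSchwartzMap (Complex.ofRealCLM.contDiff.comp χ.contDiff), hsupp, ?_, fun y => ?_⟩
  · change ((χ 0 : ℝ) : ℂ) = 1
    rw [χ.one_of_mem_closedBall (Metric.mem_closedBall_self χ.rIn_pos.le), Complex.ofReal_one]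
  · change 0 ≤ ((starRingEnd ℂ) (a (0, 0)) * (a (0, y) * ((χ y : ℝ) : ℂ))).re
    rw [← mul_assoc, Complex.re_mul_ofReal]
    by_cases hy : y ∈ Metric.ball 0 r
    · exact mul_nonneg (hsub hy).le χ.nonneg
    · rw [χ.zero_of_le_dist (by simpa using hy), mul_zero]

/-- In sheared coordinates the phase is diagonal and the oscillatory integral becomes a
superposition of products of Gaussian factors. -/
theorem norm_oscIntP_eq {N : Matrix (Fin m) (Fin m) ℝ} (hN : N * N = 0)
    (hdet : ∀ s : ℝ, (1 - s • N).det = 1) {γ : Fin m → ℝ → ℝ}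
    {φ : (Fin m → ℝ) × ℝ → (Fin m → ℝ) → ℝ}
    (hφ : ∀ x s z, φ (x, s) (z - s • N.mulVec z) =
      ∑ i, ((x - s • N.transpose.mulVec x) i * z i + γ i s * z i ^ 2 / 2))
    {a : ((Fin m → ℝ) × ℝ) × (Fin m → ℝ) → ℂ} {f : (Fin m → ℝ) → ℂ}
    {W : Type*} [TopologicalSpace W]
    [SecondCountableTopology W] [MeasurableSpace W] [BorelSpace W] {μ : Measure W} [SFinite μ]
    {h : W → ℂ} (hh : Integrable h μ) {q : W → (Fin m → ℝ) × ℝ → ℝ}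
    (hq : ∀ x, Continuous fun ξ => q ξ x) {η : W → Fin m → ℝ} (hη : Continuous η)
    (hrep : ∀ (x : (Fin m → ℝ) × ℝ) (z : Fin m → ℝ),
      Complex.exp ((∑ i, z i ^ 2 / 2 : ℝ) : ℂ) *
        (a (x, z - x.2 • N.mulVec z) * f (z - x.2 • N.mulVec z)) =
      ∫ ξ, h ξ * Complex.exp (Complex.I * ((q ξ x + ∑ i, η ξ i * z i : ℝ) : ℂ)) ∂μ)
    (lam : ℝ) (x : Fin m → ℝ) (s : ℝ) :
    ‖oscIntP lam φ a f (x, s)‖ =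
      (∏ i, ‖((Real.pi : ℂ) / ((1 - Complex.I * ((lam * γ i s : ℝ) : ℂ)) / 2)) ^ (1 / 2 : ℂ)‖) *
        ‖∫ ξ, h ξ * Complex.exp (Complex.I * (q ξ (x, s) : ℂ)) *
          ∏ i, gaussFactor (lam * (x - s • N.transpose.mulVec x) i) (lam * γ i s) (η ξ i) ∂μ‖ := by
  have h1 : oscIntP lam φ a f (x, s) =
      (∏ i, ((Real.pi : ℂ) / ((1 - Complex.I * ((lam * γ i s : ℝ) : ℂ)) / 2)) ^ (1 / 2 : ℂ)) *
        ∫ ξ, h ξ * Complex.exp (Complex.I * (q ξ (x, s) : ℂ)) *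
          ∏ i, Complex.exp (-((((lam * (x - s • N.transpose.mulVec x) i : ℝ) : ℂ) + η ξ i) ^ 2 /
            (2 * (1 - Complex.I * ((lam * γ i s : ℝ) : ℂ))))) ∂μ := by
    rw [← integral_cexp_quadratic_mul_superposition hh (hq (x, s)) hη, oscIntP,
      ← integral_comp_shear s hN (hdet s)]
    refine integral_congr_ae (.of_forall fun z => ?_)
    simp only
    rw [← hrep (x, s) z, ← mul_assoc (Complex.exp (((-∑ i, z i ^ 2 / 2 : ℝ)) : ℂ)),
      ← Complex.exp_add, hφ, mul_assoc]
    have h2 : ((-∑ i, z i ^ 2 / 2 : ℝ) : ℂ) + ((∑ i, z i ^ 2 / 2 : ℝ) : ℂ) = 0 := by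
      push_cast; ring
    rw [h2, Complex.exp_zero, one_mul, Finset.mul_sum]
    congr 4
    exact Finset.sum_congr rfl fun i _ => by ring
  have h3 : ∀ ξ, h ξ * Complex.exp (Complex.I * (q ξ (x, s) : ℂ)) *
      ∏ i, gaussFactor (lam * (x - s • N.transpose.mulVec x) i) (lam * γ i s) (η ξ i) =
      (∏ i, Complex.exp (Complex.I * (((lam * (x - s • N.transpose.mulVec x) i) ^ 2 /
        (2 * (lam * γ i s)) : ℝ) : ℂ))) *
      (h ξ * Complex.exp (Complex.I * (q ξ (x, s) : ℂ)) *
          ∏ i, Complex.exp (-((((lam * (x - s • N.transpose.mulVec x) i : ℝ) : ℂ) + η ξ i) ^ 2 /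
            (2 * (1 - Complex.I * ((lam * γ i s : ℝ) : ℂ)))))) := by
    intro ξ
    simp only [gaussFactor, Finset.prod_mul_distrib]
    ring
  simp_rw [h3]
  have h4 : ‖∏ i, Complex.exp (Complex.I * (((lam * (x - s • N.transpose.mulVec x) i) ^ 2 /
      (2 * (lam * γ i s)) : ℝ) : ℂ))‖ = 1 := by
    rw [norm_prod]
    exact Finset.prod_eq_one fun i _ => by
      rw [mul_comm Complex.I, Complex.norm_exp_ofReal_mul_I]
  rw [integral_const_mul, h1, norm_mul, norm_mul, h4, one_mul, norm_prod]

theorem exists_le_norm_oscIntP {N : Matrix (Fin m) (Fin m) ℝ} (hN : N * N = 0)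
    (hdet : ∀ s : ℝ, (1 - s • N).det = 1) (D : Finset (Fin m)) {γ : Fin m → ℝ → ℝ}
    (hγ : ∀ i ∈ D, Filter.Tendsto (γ i) (nhds 0) (nhds 1)) (hγ' : ∀ i ∉ D, ∀ s, γ i s = 0)
    {φ : (Fin m → ℝ) × ℝ → (Fin m → ℝ) → ℝ}
    (hφ : ∀ x s z, φ (x, s) (z - s • N.mulVec z) =
      ∑ i, ((x - s • N.transpose.mulVec x) i * z i + γ i s * z i ^ 2 / 2))
    {a : ((Fin m → ℝ) × ℝ) × (Fin m → ℝ) → ℂ} (ha : ContDiff ℝ (⊤ : ℕ∞) a)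
    (hac : HasCompactSupport a) (ha0 : a ((0, 0), 0) ≠ 0) :
    ∃ f : SchwartzMap (Fin m → ℝ) ℂ, f ≠ 0 ∧ ∃ c > 0, ∃ r > 0, ∃ lam₀ ≥ 1,
      ∀ lam ≥ lam₀, ∀ (x : Fin m → ℝ) (s : ℝ), |s| < r →
        (∀ i, |(x - s • N.transpose.mulVec x) i| < if i ∈ D then r else r / lam) →
        c * lam ^ (-(D.card / 2 : ℝ)) ≤ ‖oscIntP lam φ a f (x, s)‖ := by
  obtain ⟨f, hfc, hf0, hfre⟩ := exists_bump_mul_amplitude ha.continuous ha0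
  let Θ := skewShear (X := (Fin m → ℝ) × ℝ) (c := Prod.snd) continuous_snd hN
  let H : ((Fin m → ℝ) × ℝ) × (Fin m → ℝ) → ℂ := fun p =>
    Complex.exp ((∑ i, p.2 i ^ 2 / 2 : ℝ) : ℂ) *
      (a (p.1, p.2 - p.1.2 • N.mulVec p.2) * f (p.2 - p.1.2 • N.mulVec p.2))
  have hΘ : ContDiff ℝ (⊤ : ℕ∞) fun p : ((Fin m → ℝ) × ℝ) × (Fin m → ℝ) =>
      p.2 - p.1.2 • N.mulVec p.2 := by
    have h1 : ContDiff ℝ (⊤ : ℕ∞) fun z : Fin m → ℝ => N.mulVec z :=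
      (Matrix.toLin' N).toContinuousLinearMap.contDiff
    exact contDiff_snd.sub (contDiff_fst.snd.smul (h1.comp contDiff_snd))
  have hHs : ContDiff ℝ (⊤ : ℕ∞) H := by
    have hf' := f.smooth (⊤ : ℕ∞)
    refine ContDiff.mul ?_ ((ha.comp (contDiff_fst.prodMk hΘ)).mul (hf'.comp hΘ))
    have h2 : ContDiff ℝ (⊤ : ℕ∞) fun p : ((Fin m → ℝ) × ℝ) × (Fin m → ℝ) =>
        ∑ i, p.2 i ^ 2 / 2 := ContDiff.sum fun i _ => by fun_prop
    exact Complex.contDiff_exp.comp (Complex.ofRealCLM.contDiff.comp h2)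
  have hHc : HasCompactSupport H := by
    have h1 : HasCompactSupport (a ∘ Θ) := hac.comp_homeomorph Θ
    exact HasCompactSupport.mul_left (HasCompactSupport.mul_right h1)
  obtain ⟨d, h, q, η, hh, hq, hq', hq0, hη, hrep⟩ := exists_fourier_representation hHs hHc
  have hL0 : ∫ ξ, h ξ *
      ∏ i, (if i ∈ D then 1 else Complex.exp (-((η ξ i : ℂ) ^ 2 / 2))) ≠ 0 := by
    rw [← integral_superposition_pi hh hη D]
    have h1 : ∀ z, ∫ ξ, h ξ * Complex.exp (Complex.I * ((∑ i, η ξ i * z i : ℝ) : ℂ)) =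
        H (0, z) := fun z => by rw [hrep]; simp only [hq0, zero_add]
    simp_rw [h1]
    have h2 : ∀ z, H (0, z) = ((Real.exp (∑ i, z i ^ 2 / 2) : ℝ) : ℂ) * (a (0, z) * f z) :=
      fun z => by simp [H]
    have h3 := integral_pi_dirac_gaussian_ne_zero D
      (g := fun z => (starRingEnd ℂ) (a (0, 0)) * H (0, z))
      (by have := hHs.continuous; fun_prop)
      (HasCompactSupport.mul_left (f := fun _ => (starRingEnd ℂ) (a (0, 0)))
        (hHc.comp_isClosedEmbedding
          (g := fun z => ((0 : (Fin m → ℝ) × ℝ), z))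
          (Function.LeftInverse.isClosedEmbedding (f := Prod.snd)
            (fun _ => rfl) continuous_snd (by fun_prop))))
      (fun z => by
        simp only [h2]
        rw [mul_left_comm, Complex.re_ofReal_mul]
        exact mul_nonneg (Real.exp_pos _).le (hfre z))
      (by
        simp only [h2, hf0, mul_one]
        rw [mul_left_comm, Complex.re_ofReal_mul, ← Complex.normSq_eq_conj_mul_self,
          Complex.ofReal_re]
        exact mul_pos (Real.exp_pos _) (Complex.normSq_pos.2 ha0))
    rw [integral_const_mul] at h3
    exact right_ne_zero_of_mul h3
  set L := ∫ ξ, h ξ * ∏ i, (if i ∈ D then 1 else Complex.exp (-((η ξ i : ℂ) ^ 2 / 2)))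
  let l : Filter (ℝ × ((Fin m → ℝ) × ℝ)) := Filter.atTop ×ˢ nhds 0
  let β : ℝ × ((Fin m → ℝ) × ℝ) → Fin m → ℝ := fun t i =>
    if i ∈ D then t.2.1 i else t.2.1 i / t.1
  have hb : Filter.Tendsto (fun t : ℝ × ((Fin m → ℝ) × ℝ) => t.2.1) l (nhds 0) :=
    (continuous_fst.tendsto _).comp Filter.tendsto_snd
  have hs : Filter.Tendsto (fun t : ℝ × ((Fin m → ℝ) × ℝ) => t.2.2) l (nhds 0) :=
    (continuous_snd.tendsto (0 : (Fin m → ℝ) × ℝ)).comp Filter.tendsto_snd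
  have hΛ : Filter.Tendsto (fun t : ℝ × ((Fin m → ℝ) × ℝ) => t.1) l Filter.atTop :=
    Filter.tendsto_fst
  have hbi : ∀ i, Filter.Tendsto (fun t : ℝ × ((Fin m → ℝ) × ℝ) => t.2.1 i) l (nhds 0) :=
    fun i => tendsto_pi_nhds.1 hb i
  have hβ : Filter.Tendsto β l (nhds 0) := tendsto_pi_nhds.2 fun i => by
    by_cases hi : i ∈ D
    · simpa [β, hi] using hbi i
    · simp only [β, hi, if_false]
      exact (hbi i).div_atTop hΛ
  have hx : Filter.Tendsto (fun t => (β t + t.2.2 • N.transpose.mulVec (β t), t.2.2)) l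
      (nhds (0 : (Fin m → ℝ) × ℝ)) := by
    have h1 : Continuous fun b : (Fin m → ℝ) × ℝ =>
        (b.1 + b.2 • N.transpose.mulVec b.1, b.2) := by fun_prop
    have h2 := (h1.tendsto (0, 0)).comp (hβ.prodMk_nhds hs)
    simpa [Function.comp_def] using! h2
  have hlim := tendsto_integral_gaussFactor hh hq hq' hq0 hη D hΛ hx
    (β := β) (γ := fun t i => γ i t.2.2)
    (fun i _ => tendsto_pi_nhds.1 hβ i) (fun i hi => (hγ i hi).comp hs)
    (fun i hi => by
      refine (hbi i).congr' ?_
      filter_upwards [hΛ.eventually_gt_atTop 0] with t ht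
      simp only [β, hi, if_false]
      field_simp) (fun i hi t => hγ' i hi _)
  have hev : ∀ᶠ t : ℝ × ((Fin m → ℝ) × ℝ) in l, (∀ i ∈ D, |γ i t.2.2| ≤ 2) ∧ ‖L‖ / 2 ≤
      ‖∫ ξ, h ξ * Complex.exp (Complex.I *
        (q ξ (β t + t.2.2 • N.transpose.mulVec (β t), t.2.2) : ℂ)) *
        ∏ i, gaussFactor (t.1 * β t i) (t.1 * γ i t.2.2) (η ξ i)‖ := by
    refine Filter.Eventually.and ?_ ?_
    · rw [Filter.eventually_all_finset]
      intro i hi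
      have h1 := ((hγ i hi).comp hs).abs
      rw [abs_one] at h1
      exact (h1.eventually (gt_mem_nhds one_lt_two)).mono fun t ht => ht.le
    · exact (hlim.norm.eventually (lt_mem_nhds (half_lt_self (norm_pos_iff.2 hL0)))).mono
        fun t ht => ht.le
  obtain ⟨P, hP, Q, hQ, hPQ⟩ := Filter.eventually_prod_iff.1 hev
  obtain ⟨lam₁, hlam₁⟩ := Filter.eventually_atTop.1 hP
  obtain ⟨r, hr, hQr⟩ := Metric.eventually_nhds_iff_ball.1 hQ
  refine ⟨f, fun h => by simp [h] at hf0, ‖L‖ / 2, half_pos (norm_pos_iff.2 hL0), r, hr,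
    max 1 lam₁, le_max_left _ _, fun lam hlam x s hsr hxr => ?_⟩
  have hlam1 : 1 ≤ lam := (le_max_left _ _).trans hlam
  have hlam0 : 0 < lam := by linarith
  set y := x - s • N.transpose.mulVec x with hy
  let b : Fin m → ℝ := fun i => if i ∈ D then y i else lam * y i
  have hβy : β (lam, (b, s)) = y := by
    ext i
    simp only [β, b]
    split_ifs
    · rfl
    · field_simp
  have hxy : y + s • N.transpose.mulVec y = x := by
    have : N.transpose * N.transpose = 0 := by
      rw [← Matrix.transpose_mul, hN, Matrix.transpose_zero]
    simp [hy, Matrix.mulVec_sub, Matrix.mulVec_smul, Matrix.mulVec_mulVec, this]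
  have hbs : (b, s) ∈ Metric.ball (0 : (Fin m → ℝ) × ℝ) r := by
    rw [mem_ball_zero_iff, Prod.norm_def, max_lt_iff]
    refine ⟨(pi_norm_lt_iff hr).2 fun i => ?_, hsr⟩
    have := hxr i
    simp only [b, Real.norm_eq_abs]
    split_ifs at this ⊢
    · exact this
    · rwa [abs_mul, abs_of_pos hlam0, mul_comm, ← lt_div_iff₀ hlam0]
  obtain ⟨hγ2, hmain⟩ := hPQ (hlam₁ lam ((le_max_right _ _).trans hlam)) (hQr _ hbs)
  simp only [hβy, hxy] at hmain hγ2
  rw [norm_oscIntP_eq hN hdet hφ hh hq' hη (fun x z => hrep x z) lam x s, mul_comm]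
  refine mul_le_mul ?_ hmain (by positivity) (Finset.prod_nonneg fun _ _ => norm_nonneg _)
  have h1 : lam ^ (-(D.card / 2 : ℝ)) =
      ∏ i, (if i ∈ D then lam else 1) ^ (-(1 / 2 : ℝ)) := by
    rw [Real.finsetProd_rpow _ _ (fun i _ => by split_ifs <;> positivity), Finset.prod_ite_mem,
      Finset.univ_inter, Finset.prod_const, ← Real.rpow_natCast, ← Real.rpow_mul hlam0.le]
    congr 1
    ring
  rw [h1]
  refine Finset.prod_le_prod (fun i _ => by split_ifs <;> positivity) fun i _ => ?_
  refine rpow_neg_half_le_norm_cpow (by split_ifs <;> positivity) ?_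
  split_ifs with hi
  · rw [abs_mul, abs_of_pos hlam0]
    nlinarith [hγ2 i hi]
  · simp [hγ' i hi]

end ShearedPhase

theorem transpose_shear_det {m : ℕ} {N : Matrix (Fin m) (Fin m) ℝ} {s : ℝ}
    (hdet : (1 - s • N).det = 1) : (1 - s • N.transpose).det = 1 := by
  rw [← Matrix.det_transpose, ← hdet]
  simp

/-- The set of points whose sheared coordinates lie in a box. -/
def shearedBox {m : ℕ} (N : Matrix (Fin m) (Fin m) ℝ) (r : ℝ) (ρ : Fin m → ℝ) :
    Set ((Fin m → ℝ) × ℝ) :=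
  {q | |q.2| < r ∧ ∀ i, |(q.1 - q.2 • N.mulVec q.1) i| < ρ i}

theorem measurableSet_shearedBox {m : ℕ} (N : Matrix (Fin m) (Fin m) ℝ) (r : ℝ)
    (ρ : Fin m → ℝ) : MeasurableSet (shearedBox N r ρ) := by
  have h : Continuous fun q : (Fin m → ℝ) × ℝ => q.1 - q.2 • N.mulVec q.1 :=
    continuous_fst.sub (continuous_snd.smul (continuous_const.matrix_mulVec continuous_fst))
  have h₁ : IsOpen {q : (Fin m → ℝ) × ℝ | |q.2| < r} :=
    isOpen_lt continuous_snd.abs continuous_const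
  have h₂ : IsOpen {q : (Fin m → ℝ) × ℝ | ∀ i, |(q.1 - q.2 • N.mulVec q.1) i| < ρ i} := by
    simp only [Set.ofPred_forall]
    exact isOpen_iInter_of_finite fun i =>
      isOpen_lt ((continuous_apply i).comp h).abs continuous_const
  exact (h₁.inter h₂).measurableSet

theorem volume_shearedBox {m : ℕ} {N : Matrix (Fin m) (Fin m) ℝ}
    (hdet : ∀ s : ℝ, (1 - s • N).det = 1) (r : ℝ) (ρ : Fin m → ℝ) :
    volume (shearedBox N r ρ) = ENNReal.ofReal (2 * r) * ∏ i, ENNReal.ofReal (2 * ρ i) := by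
  have hbox : volume {x : Fin m → ℝ | ∀ i, |x i| < ρ i} = ∏ i, ENNReal.ofReal (2 * ρ i) := by
    have : {x : Fin m → ℝ | ∀ i, |x i| < ρ i} =
        Set.univ.pi fun i => Set.Ioo (-ρ i) (ρ i) := by
      ext x
      simp [abs_lt]
    rw [this, Real.volume_pi_Ioo]
    simp [two_mul]
  have hmeas : MeasurableSet {x : Fin m → ℝ | ∀ i, |x i| < ρ i} := by
    simp only [Set.ofPred_forall]
    exact MeasurableSet.iInter fun i => measurableSet_lt (by fun_prop) measurable_const
  have hslice (s : ℝ) : volume ((fun x => (x, s)) ⁻¹' shearedBox N r ρ) =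
      (Set.Ioo (-r) r).indicator (fun _ => ∏ i, ENNReal.ofReal (2 * ρ i)) s := by
    by_cases hs : |s| < r
    · rw [Set.indicator_of_mem (by simpa [abs_lt] using hs), ← hbox]
      conv_rhs => rw [← map_shear_volume (hdet s)]
      rw [Measure.map_apply (by
        exact ((continuous_id.sub ((continuous_const.matrix_mulVec
          continuous_id).const_smul s))).measurable) hmeas]
      congr 1
      ext x
      simp [shearedBox, hs]
    · rw [Set.indicator_of_notMem (by simpa [abs_lt] using hs)]
      simp [shearedBox, hs]
  rw [Measure.volume_eq_prod, Measure.prod_apply_symm (measurableSet_shearedBox N r ρ)]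
  simp_rw [hslice]
  rw [lintegral_indicator measurableSet_Ioo, setLIntegral_const, Real.volume_Ioo, mul_comm]
  ring_nf

theorem exists_rpow_mul_eLpNorm_le_eLpNorm_oscIntP {m : ℕ} {N : Matrix (Fin m) (Fin m) ℝ}
    (hN : N * N = 0) (hdet : ∀ s : ℝ, (1 - s • N).det = 1) (D : Finset (Fin m))
    {γ : Fin m → ℝ → ℝ}
    (hγ : ∀ i ∈ D, Filter.Tendsto (γ i) (nhds 0) (nhds 1)) (hγ' : ∀ i ∉ D, ∀ s, γ i s = 0)
    {φ : ((Fin m → ℝ) × ℝ) → (Fin m → ℝ) → ℝ}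
    (hφ : ∀ x s z, φ (x, s) (z - s • N.mulVec z) =
      ∑ i, ((x - s • N.transpose.mulVec x) i * z i + γ i s * z i ^ 2 / 2))
    {a : (((Fin m → ℝ) × ℝ) × (Fin m → ℝ)) → ℂ}
    (ha : ContDiff ℝ (⊤ : ℕ∞) a) (hac : HasCompactSupport a) (ha0 : a ((0, 0), 0) ≠ 0)
    {p : ℝ} (hp : 2 ≤ p) :
    ∃ c : ℝ, 0 < c ∧ ∃ lam₀ : ℝ, 1 ≤ lam₀ ∧ ∀ lam : ℝ, lam₀ ≤ lam →
      ∃ f : SchwartzMap (Fin m → ℝ) ℂ, f ≠ 0 ∧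
        ENNReal.ofReal (c * lam ^ (-(D.card / 2 : ℝ) - (Dᶜ.card : ℝ) / p))
            * eLpNorm (⇑f) (ENNReal.ofReal p) volume
          ≤ eLpNorm (oscIntP lam φ a (⇑f)) (ENNReal.ofReal p) volume := by
  obtain ⟨f, hf, c, hc, r, hr, lam₀, hlam₀, h⟩ :=
    exists_le_norm_oscIntP hN hdet D hγ hγ' hφ ha hac ha0
  have hp0 : 0 < p := by linarith
  set A : ℝ := (eLpNorm (⇑f) (ENNReal.ofReal p) volume).toReal with hA
  have hA0 : 0 ≤ A := ENNReal.toReal_nonneg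
  have hfA : eLpNorm (⇑f) (ENNReal.ofReal p) volume = ENNReal.ofReal A :=
    (ENNReal.ofReal_toReal (f.memLp _ volume).2.ne).symm
  set K : ℝ := c * ((2 * r) ^ (m + 1)) ^ (1 / p) with hK
  have hK0 : 0 < K := by positivity
  refine ⟨K / (A + 1), by positivity, lam₀, hlam₀, fun lam hlam => ⟨f, hf, ?_⟩⟩
  have hl : 0 < lam := by linarith
  set ρ : Fin m → ℝ := fun i => if i ∈ D then r else r / lam with hρ
  set E := shearedBox N.transpose r ρ with hE
  have hEm : MeasurableSet E := measurableSet_shearedBox _ _ _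
  have hprod : ∏ i, (2 * ρ i) = (2 * r) ^ m * lam ^ (-(Dᶜ.card : ℝ)) := by
    have h1 : ∀ i, 2 * ρ i = 2 * r * if i ∈ D then 1 else lam⁻¹ := fun i => by
      by_cases hi : i ∈ D <;> simp [hρ, hi, div_eq_mul_inv, mul_assoc]
    simp_rw [h1, Finset.prod_mul_distrib]
    rw [Finset.prod_ite, Real.rpow_neg hl.le, Real.rpow_natCast]
    simp [Finset.compl_eq_univ_sdiff, Finset.filter_notMem_eq_sdiff, mul_pow]
  have hvol : volume E =
      ENNReal.ofReal ((2 * r) ^ (m + 1) * lam ^ (-(Dᶜ.card : ℝ))) := by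
    rw [hE, volume_shearedBox (fun s => transpose_shear_det (hdet s)),
      ← ENNReal.ofReal_prod_of_nonneg, hprod, ← ENNReal.ofReal_mul (by positivity)]
    · congr 1
      ring
    · intro i _
      simp only [hρ]
      split_ifs <;> positivity
  have hlow : eLpNorm (E.indicator fun _ => (c * lam ^ (-(D.card / 2 : ℝ)) : ℝ))
      (ENNReal.ofReal p) volume ≤ eLpNorm (oscIntP lam φ a (⇑f)) (ENNReal.ofReal p) volume := by
    refine eLpNorm_mono fun q => ?_
    by_cases hq : q ∈ E
    · rw [Set.indicator_of_mem hq, Real.norm_of_nonneg (by positivity)]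
      exact h lam hlam q.1 q.2 hq.1 hq.2
    · simp [Set.indicator_of_notMem hq]
  refine le_trans ?_ hlow
  rw [eLpNorm_indicator_const hEm (by simpa using hp0) ENNReal.ofReal_ne_top, hvol, hfA,
    ENNReal.toReal_ofReal hp0.le, ENNReal.ofReal_rpow_of_nonneg (by positivity) (by positivity),
    Real.enorm_eq_ofReal (by positivity), ← ENNReal.ofReal_mul (by positivity),
    ← ENNReal.ofReal_mul (by positivity)]
  refine ENNReal.ofReal_le_ofReal ?_
  rw [Real.mul_rpow (by positivity) (by positivity), ← Real.rpow_mul hl.le]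
  have hexp : lam ^ (-(D.card / 2 : ℝ) - (Dᶜ.card : ℝ) / p) =
      lam ^ (-(D.card / 2 : ℝ)) * lam ^ (-(Dᶜ.card : ℝ) * (1 / p)) := by
    rw [← Real.rpow_add hl]
    congr 1
    ring
  rw [hexp]
  have hA1 : A / (A + 1) ≤ 1 := by rw [div_le_one (by positivity)]; linarith
  calc K / (A + 1) * (lam ^ (-(D.card / 2 : ℝ)) * lam ^ (-(Dᶜ.card : ℝ) * (1 / p))) * A
      = (K * (lam ^ (-(D.card / 2 : ℝ)) * lam ^ (-(Dᶜ.card : ℝ) * (1 / p)))) *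
          (A / (A + 1)) := by ring
    _ ≤ K * (lam ^ (-(D.card / 2 : ℝ)) * lam ^ (-(Dᶜ.card : ℝ) * (1 / p))) :=
        mul_le_of_le_one_right (by positivity) hA1
    _ = _ := by rw [hK]; ring

/-- The nilpotent matrix `N` with `N i k = 1` exactly when `i` is even and `k = i + 1`. -/
def pairShift (m : ℕ) : Matrix (Fin m) (Fin m) ℝ :=
  Matrix.of fun i k => if Even i.val ∧ k.val = i.val + 1 then 1 else 0

theorem pairShift_mul_self (m : ℕ) : pairShift m * pairShift m = 0 := by
  ext i k
  rw [Matrix.mul_apply]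
  refine Finset.sum_eq_zero fun j _ => ?_
  simp only [pairShift, Matrix.of_apply]
  split_ifs with h1 h2 <;> try simp
  obtain ⟨⟨a, ha⟩, hj⟩ := h1
  obtain ⟨⟨b, hb⟩, -⟩ := h2
  omega

theorem det_one_sub_smul_pairShift (m : ℕ) (s : ℝ) : (1 - s • pairShift m).det = 1 := by
  rw [Matrix.det_of_isUpperTriangular]
  · simp [pairShift]
  · intro i j hij
    have hij' : j.val < i.val := hij
    have h1 : i ≠ j := fun h => by simp [h] at hij'
    have h2 : ¬ (Even i.val ∧ j.val = i.val + 1) := by omega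
    simp [pairShift, h1, h2]

theorem pairShift_mulVec_of_even {m : ℕ} {i k : Fin m} (hi : Even i.val)
    (hk : k.val = i.val + 1) (z : Fin m → ℝ) : (pairShift m).mulVec z i = z k := by
  rw [Matrix.mulVec, dotProduct, Finset.sum_eq_single k]
  · simp [pairShift, hi, hk]
  · intro j _ hj
    have : ¬ (Even i.val ∧ j.val = i.val + 1) := fun h => hj (Fin.ext (by omega))
    simp [pairShift, this]
  · simp

theorem pairShift_mulVec_of_odd {m : ℕ} {i : Fin m} (hi : ¬ Even i.val)
    (z : Fin m → ℝ) : (pairShift m).mulVec z i = 0 := by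
  rw [Matrix.mulVec, dotProduct]
  exact Finset.sum_eq_zero fun j _ => by simp [pairShift, hi]

theorem pairShift_mulVec_of_last {m : ℕ} {i : Fin m} (hi : i.val + 1 = m)
    (z : Fin m → ℝ) : (pairShift m).mulVec z i = 0 := by
  rw [Matrix.mulVec, dotProduct]
  refine Finset.sum_eq_zero fun j _ => ?_
  have : ¬ (Even i.val ∧ j.val = i.val + 1) := fun h => by have := j.isLt; omega
  simp [pairShift, this]

theorem dotProduct_sub_smul_mulVec {m : ℕ} (N : Matrix (Fin m) (Fin m) ℝ) (s : ℝ)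
    (x z : Fin m → ℝ) :
    x ⬝ᵥ (z - s • N.mulVec z) = (x - s • N.transpose.mulVec x) ⬝ᵥ z := by
  rw [dotProduct_sub, sub_dotProduct, dotProduct_smul, smul_dotProduct,
    Matrix.dotProduct_mulVec, Matrix.mulVec_transpose]

/-- The diagonal coefficients of the sheared phase. -/
def evenCoeff (m : ℕ) (i : Fin m) (s : ℝ) : ℝ :=
  if Even i.val then (if i.val + 1 = m then 1 + s else 1) else 0

theorem sum_range_two_mul_add_one {M : Type*} [AddCommMonoid M] (g : ℕ → M) (J : ℕ) :
    ∑ i ∈ Finset.range (2 * J + 1), g i =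
      ∑ j ∈ Finset.range J, (g (2 * j) + g (2 * j + 1)) + g (2 * J) := by
  induction J with
  | zero => simp
  | succ J ih =>
    rw [show 2 * (J + 1) + 1 = 2 * J + 1 + 1 + 1 by ring, Finset.sum_range_succ,
      Finset.sum_range_succ, ih, Finset.sum_range_succ]
    simp only [show 2 * (J + 1) = 2 * J + 1 + 1 by ring, add_assoc]

theorem sum_fin_eq_sum_idx {M : Type*} [AddCommMonoid M] {m J : ℕ} (hm : 0 < m)
    (hJ : m = 2 * J + 1) (g : Fin m → M) :
    ∑ i, g i = ∑ j ∈ Finset.range J, (g (idx m hm (2 * j)) + g (idx m hm (2 * j + 1))) +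
      g (idx m hm (2 * J)) := by
  rw [← sum_range_two_mul_add_one (fun k => g (idx m hm k)), ← hJ, ← Fin.sum_univ_eq_sum_range]
  refine Finset.sum_congr rfl fun i _ => congrArg g (Fin.ext ?_)
  exact (Nat.mod_eq_of_lt i.isLt).symm

theorem bourgainPhaseEven_shear {n : ℕ} (hn : 4 ≤ n) (heven : Even n)
    (x : Fin (n - 1) → ℝ) (s : ℝ) (z : Fin (n - 1) → ℝ) :
    bourgainPhaseEven n hn (x, s) (z - s • (pairShift (n - 1)).mulVec z) =
      ∑ i, ((x - s • (pairShift (n - 1)).transpose.mulVec x) i * z i +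
        evenCoeff (n - 1) i s * z i ^ 2 / 2) := by
  have hm : 0 < n - 1 := by omega
  obtain ⟨k, hk⟩ := heven
  have hJ : n - 1 = 2 * ((n - 2) / 2) + 1 := by omega
  have hJ' : n - 2 = 2 * ((n - 2) / 2) := by omega
  have hlin := dotProduct_sub_smul_mulVec (pairShift (n - 1)) s x z
  rw [Finset.sum_add_distrib]
  simp only [dotProduct] at hlin
  rw [bourgainPhaseEven, hlin, add_assoc]
  congr 1
  have hidx (k : ℕ) (hk : k < n - 1) : (idx (n - 1) hm k).val = k := Nat.mod_eq_of_lt hk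
  rw [sum_fin_eq_sum_idx hm hJ, pairSum, Finset.mul_sum]
  congr 1
  · refine Finset.sum_congr rfl fun j hj => ?_
    have hj : j < (n - 2) / 2 := Finset.mem_range.1 hj
    have e0 := hidx (2 * j) (by omega)
    have e1 := hidx (2 * j + 1) (by omega)
    have he : Even (idx (n - 1) hm (2 * j)).val := by rw [e0]; simp
    have ho : ¬ Even (idx (n - 1) hm (2 * j + 1)).val := by rw [e1]; simp
    have hl : (idx (n - 1) hm (2 * j)).val + 1 ≠ n - 1 := by omega
    simp only [Pi.sub_apply, Pi.smul_apply, pairShift_mulVec_of_odd ho,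
      pairShift_mulVec_of_even he (e1.trans (by rw [e0])), evenCoeff, if_pos he, if_neg ho,
      if_neg hl, smul_eq_mul]
    ring
  · have e := hidx (n - 2) (by omega)
    rw [← hJ']
    have he : Even (idx (n - 1) hm (n - 2)).val := by rw [e, hJ']; simp
    have hl : (idx (n - 1) hm (n - 2)).val + 1 = n - 1 := by omega
    simp only [Pi.sub_apply, Pi.smul_apply, pairShift_mulVec_of_last hl, evenCoeff, if_pos he,
      if_pos hl, smul_eq_mul]
    ring

theorem card_filter_even_fin {m J : ℕ} (hJ : m = 2 * J + 1) :
    (Finset.univ.filter fun i : Fin m => Even i.val).card = J + 1 := by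
  rw [Finset.card_filter, sum_fin_eq_sum_idx (by omega) hJ]
  have hidx (k : ℕ) (hk : k < m) : (idx m (by omega) k).val = k := Nat.mod_eq_of_lt hk
  rw [hidx (2 * J) (by omega), Finset.sum_congr rfl (g := fun _ => 1) fun j hj => ?_]
  · simp
  · have hj : j < J := Finset.mem_range.1 hj
    rw [hidx _ (by omega), hidx _ (by omega)]
    simp

/-- Bourgain's counterexample, even dimensions: for even `n ≥ 4` and any
amplitude `a ∈ C_c^∞` supported in a sufficiently small neighbourhood of the origin with
`a(0;0) ≠ 0`, for every `p ≥ 2` there are `c > 0` and `λ₀ ≥ 1` such that for every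
`λ ≥ λ₀` some nonzero Schwartz `f` satisfies
`‖T_λ f‖_{L^p(ℝⁿ)} ≥ c λ^{−n/4 − (n−2)/(2p)} ‖f‖_{L^p(ℝ^{n−1})}`. -/
theorem bourgain_counterexample_even (n : ℕ) (hn : 4 ≤ n) (heven : Even n) :
    ∃ δ₀ : ℝ, 0 < δ₀ ∧
      ∀ a : (((Fin (n - 1) → ℝ) × ℝ) × (Fin (n - 1) → ℝ)) → ℂ,
        ContDiff ℝ (⊤ : ℕ∞) a → HasCompactSupport a →
        tsupport a ⊆ Metric.ball 0 δ₀ → a ((0, 0), 0) ≠ 0 →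
        ∀ p : ℝ, 2 ≤ p →
          ∃ c : ℝ, 0 < c ∧ ∃ lam₀ : ℝ, 1 ≤ lam₀ ∧
            ∀ lam : ℝ, lam₀ ≤ lam →
              ∃ f : SchwartzMap (Fin (n - 1) → ℝ) ℂ, f ≠ 0 ∧
                ENNReal.ofReal (c * lam ^ (-((n : ℝ) / 4) - ((n : ℝ) - 2) / (2 * p)))
                    * eLpNorm (⇑f) (ENNReal.ofReal p) volume
                  ≤ eLpNorm (oscIntP lam (bourgainPhaseEven n hn) a (⇑f))
                      (ENNReal.ofReal p) volume := by
  refine ⟨1, one_pos, fun a ha hac _ ha0 p hp => ?_⟩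
  obtain ⟨k, hk⟩ := heven
  obtain ⟨J, hJ⟩ : ∃ J, n = 2 * J + 2 := ⟨k - 1, by omega⟩
  have hcard := card_filter_even_fin (m := n - 1) (J := J) (by omega)
  set D := Finset.univ.filter fun i : Fin (n - 1) => Even i.val with hD
  have hcompl : Dᶜ.card = J := by
    rw [Finset.card_compl, Fintype.card_fin, hcard]
    omega
  have hγ : ∀ i ∈ D, Filter.Tendsto (evenCoeff (n - 1) i) (nhds 0) (nhds 1) := by
    intro i hi
    have hi : Even i.val := by simpa [hD] using hi
    have hcont : Continuous (evenCoeff (n - 1) i) := by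
      unfold evenCoeff
      split_ifs <;> fun_prop
    simpa [evenCoeff, hi] using hcont.tendsto 0
  obtain ⟨c, hc, lam₀, hlam₀, h⟩ := exists_rpow_mul_eLpNorm_le_eLpNorm_oscIntP
    (pairShift_mul_self (n - 1)) (det_one_sub_smul_pairShift (n - 1)) D hγ
    (fun i hi s => by
      have hi : ¬ Even i.val := by simpa [hD] using hi
      simp [evenCoeff, hi])
    (bourgainPhaseEven_shear hn ⟨k, hk⟩) ha hac ha0 hp
  refine ⟨c, hc, lam₀, hlam₀, fun lam hlam => ?_⟩
  have hexp : -((n : ℝ) / 4) - ((n : ℝ) - 2) / (2 * p) =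
      -(D.card / 2 : ℝ) - (Dᶜ.card : ℝ) / p := by
    have hp0 : p ≠ 0 := by linarith
    rw [hcard, hcompl, hJ]
    push_cast
    field_simp
    ring
  rw [hexp]
  exact h lam hlam
end
end
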